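/- arXiv:2604.08394 — 2 statements merged into one kernel-verified Lean document; each statement's English description precedes it below -/
import Mathlib

section
/- For any k ≥ 1, m ≥ 1 and any vectors y, z ∈ ℤ_{≥0}^k, the skew Gelfand–Tsetlin polytope GT_k^m(y,z) is Ehrhart positive: there exists a polynomial p ∈ ℚ[n] with nonnegative coefficients such that for all integers n ≥ 1, p(n) equals the number of integer points (x_{i,j}) ∈ ℤ^{km} satisfying x_{i,j} ≤ x_{i,j+1} ≤ x_{i+1,j} for all meaningful indices, where x_{i,0} := n·z̃_i and x_{i,m+1} := n·ỹ_i for all i ∈ [k]. -/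
/-- The entries of a Gelfand–Tsetlin pattern extended by the boundary conditions
`x_{i,0} = zt i` and `x_{i,m+1} = yt i`. -/
def gtExt (k m : ℕ) (zt yt : Fin k → ℤ) (x : Fin k → Fin m → ℤ)
    (i : Fin k) (j : Fin (m + 2)) : ℤ :=
  if h0 : (j : ℕ) = 0 then zt i
  else if h1 : (j : ℕ) = m + 1 then yt i
  else x i ⟨(j : ℕ) - 1, by have := j.isLt; omega⟩

/-- The defining inequalities `x_{i,j} ≤ x_{i,j+1} ≤ x_{i+1,j}` (for all meaningful
indices `i ∈ [k]`, `0 ≤ j ≤ m`) of the skew Gelfand–Tsetlin polytope, with the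
conventions `x_{i,0} = zt i` and `x_{i,m+1} = yt i`. -/
def gtCond (k m : ℕ) (zt yt : Fin k → ℤ) (x : Fin k → Fin m → ℤ) : Prop :=
  (∀ (i : Fin k) (j : Fin (m + 1)),
    gtExt k m zt yt x i j.castSucc ≤ gtExt k m zt yt x i j.succ) ∧
  (∀ (i : Fin k) (hi : (i : ℕ) + 1 < k) (j : Fin (m + 1)),
    gtExt k m zt yt x i j.succ ≤ gtExt k m zt yt x ⟨(i : ℕ) + 1, hi⟩ j.castSucc)

namespace GTP

open Finset

/-- coefficient of `u^l` in `(1-u)^(-v)` -/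
noncomputable def hh (v : ℚ) (l : ℤ) : ℚ :=
  if l < 0 then 0 else (∏ s ∈ range l.toNat, (v + s)) / (l.toNat.factorial : ℚ)

lemma hh_neg (v : ℚ) {l : ℤ} (h : l < 0) : hh v l = 0 := by simp [hh, h]

lemma hh_nat (v : ℚ) (l : ℕ) : hh v l = (∏ s ∈ range l, (v + s)) / (l.factorial : ℚ) := by
  simp [hh]

lemma hh_zero (v : ℚ) : hh v 0 = 1 := by simp [hh]

lemma hh_pascal (v : ℚ) (l : ℤ) : hh v l = hh (v + 1) l - hh (v + 1) (l - 1) := by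
  rcases lt_trichotomy l 0 with h | h | h
  · rw [hh_neg _ h, hh_neg _ h, hh_neg _ (by omega)]; simp
  · subst h; rw [hh_zero, hh_zero, hh_neg _ (by omega)]; simp
  · obtain ⟨n, rfl⟩ : ∃ n : ℕ, l = ((n + 1 : ℕ) : ℤ) := ⟨(l - 1).toNat, by omega⟩
    have e : (((n + 1 : ℕ) : ℤ) - 1) = (n : ℤ) := by push_cast; ring
    rw [e, hh_nat, hh_nat, hh_nat, prod_range_succ', prod_range_succ (fun s : ℕ => v + 1 + (s : ℚ)),
      Nat.factorial_succ]
    have hp : ∏ k ∈ range n, (v + ((k + 1 : ℕ) : ℚ)) = ∏ s ∈ range n, (v + 1 + (s : ℚ)) := by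
      apply prod_congr rfl; intro s _; push_cast; ring
    rw [hp]
    have h1 : (n.factorial : ℚ) ≠ 0 := by positivity
    have h2 : ((n : ℚ) + 1) ≠ 0 := by positivity
    push_cast
    field_simp
    ring

lemma hh_vanish (a : ℕ) {l : ℤ} (h : (a : ℤ) < l) : hh (-(a : ℚ)) l = 0 := by
  obtain ⟨n, rfl⟩ : ∃ n : ℕ, l = (n : ℤ) := ⟨l.toNat, by omega⟩
  rw [hh_nat, prod_eq_zero (i := a) (by simp; omega) (by ring)]; simp

lemma hh_one {l : ℤ} (h : 0 ≤ l) : hh 1 l = 1 := by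
  obtain ⟨n, rfl⟩ : ∃ n : ℕ, l = (n : ℤ) := ⟨l.toNat, by omega⟩
  rw [hh_nat]
  have : ∏ s ∈ range n, ((1 : ℚ) + s) = n.factorial := by
    induction n with
    | zero => simp
    | succ n ih => rw [prod_range_succ, ih (by omega), Nat.factorial_succ]; push_cast; ring
  rw [this, div_self]; positivity

/-- The summation lemma behind Kreweras' formula. -/
lemma sum_alt {V : Type*} [AddCommGroup V] [Module ℚ V] (T : ℤ) (p : ℕ) :
    ∀ (F : V [⋀^Fin p]→ₗ[ℚ] ℚ) (g G : ℕ → ℤ → V)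
      (_ : ∀ j t, g j t = G j t - G j (t + 1))
      (_ : ∀ j t, G j (t + 1) = g (j + 1) t)
      (_ : ∀ q, p = q + 1 → G q (T + 1) = 0)
      (m : Fin p → ℤ) (_ : Monotone m) (_ : ∀ j, m j ≤ T),
      ∑ n ∈ (Icc m (fun _ => T)).filter Monotone, F (fun j => g j (n j)) =
        F (fun j => G j (m j)) := by
  induction p with
  | zero =>
    intro F g G _ _ _ m _ _
    have : (Icc m (fun _ => T)).filter Monotone = {m} := by
      ext x; have := Subsingleton.elim x m; subst this; simp [Subsingleton.monotone]
    rw [this, sum_singleton]; congr 1; ext j; exact j.elim0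
  | succ p ih =>
    intro F g G h1 h2 h3 m hm hT
    have tele : ∀ a b : ℤ, a ≤ b + 1 → ∑ t ∈ Icc a b, g 0 t = G 0 a - G 0 (b + 1) := by
      intro a b hab
      obtain ⟨n, hn⟩ : ∃ n : ℕ, b + 1 = a + n := ⟨(b + 1 - a).toNat, by omega⟩
      have hb : b = a + n - 1 := by omega
      subst hb
      clear hn hab
      induction n with
      | zero => simp
      | succ n ihn =>
        have : Icc a (a + ((n + 1 : ℕ) : ℤ) - 1) = insert (a + (n : ℤ)) (Icc a (a + (n : ℤ) - 1)) := by
          ext x; simp only [mem_Icc, mem_insert]; push_cast; omega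
        rw [this, sum_insert (by simp), ihn, h1]
        have e1 : a + (n : ℤ) - 1 + 1 = a + n := by ring
        have e2 : a + ((n + 1 : ℕ) : ℤ) - 1 + 1 = a + n + 1 := by push_cast; ring
        rw [e1, e2]; abel
    let bd : (Fin p → ℤ) → ℤ := fun n' => if h : 0 < p then n' ⟨0, h⟩ else T
    have key : ∑ n ∈ (Icc m (fun _ => T)).filter Monotone, F (fun j => g j (n j)) =
        ∑ n' ∈ (Icc (Fin.tail m) (fun _ => T)).filter Monotone, ∑ a ∈ Icc (m 0) (bd n'),
          F (Matrix.vecCons (g 0 a) (fun j => g (j + 1) (n' j))) := by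
      rw [sum_sigma']
      refine sum_nbij' (fun n => ⟨Fin.tail n, n 0⟩) (fun x => Fin.cons x.2 x.1) ?_ ?_ ?_ ?_ ?_
      · intro n hn
        simp only [mem_filter, mem_Icc, Pi.le_def, mem_sigma] at hn ⊢
        refine ⟨⟨⟨fun j => hn.1.1 j.succ, fun j => hn.1.2 j.succ⟩, ?_⟩, hn.1.1 0, ?_⟩
        · intro i j hij; exact hn.2 (Fin.succ_le_succ_iff.2 hij)
        · simp only [bd]; split_ifs with h
          · exact hn.2 (Fin.zero_le _)
          · exact hn.1.2 0
      · rintro ⟨n', a⟩ hn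
        simp only [mem_filter, mem_Icc, Pi.le_def, mem_sigma] at hn ⊢
        have ha : ∀ j, a ≤ n' j := by
          intro j
          have := hn.2.2
          have hp : 0 < p := j.pos
          simp only [bd, hp, dif_pos] at this
          exact this.trans (hn.1.2 (by simp [Fin.le_def]))
        have haT : a ≤ T := by
          by_cases hp : 0 < p
          · exact (ha ⟨0, hp⟩).trans (hn.1.1.2 _)
          · have := hn.2.2; simpa [bd, hp] using this
        refine ⟨⟨fun j => ?_, fun j => ?_⟩, ?_⟩
        · refine Fin.cases ?_ (fun j => ?_) j
          · exact hn.2.1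
          · exact hn.1.1.1 j
        · refine Fin.cases ?_ (fun j => ?_) j
          · exact haT
          · exact hn.1.1.2 j
        · intro i j
          refine Fin.cases ?_ (fun i => ?_) i <;> refine Fin.cases ?_ (fun j => ?_) j
          · simp
          · intro _; exact ha j
          · intro h; simp at h
          · intro h; exact hn.1.2 (Fin.succ_le_succ_iff.1 h)
      · intro n _; exact Fin.cons_self_tail n
      · rintro ⟨n', a⟩ _; simp
      · intro n _
        congr 1; ext j
        refine Fin.cases ?_ (fun j => ?_) j
        · rfl
        · simp [Fin.tail]
    rw [key]
    have inner : ∀ n' ∈ (Icc (Fin.tail m) (fun _ => T)).filter Monotone,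
        ∑ a ∈ Icc (m 0) (bd n'), F (Matrix.vecCons (g 0 a) (fun j => g (j + 1) (n' j))) =
        (F.curryLeft (G 0 (m 0))) (fun j => g (j + 1) (n' j)) := by
      intro n' hn
      simp only [mem_filter, mem_Icc, Pi.le_def] at hn
      have e : ∑ a ∈ Icc (m 0) (bd n'), F (Matrix.vecCons (g 0 a) (fun j => g (j + 1) (n' j))) =
          (F.curryLeft (∑ a ∈ Icc (m 0) (bd n'), g 0 a)) (fun j => g (j + 1) (n' j)) := by
        have e' : ∀ S : Finset ℤ, ∑ a ∈ S, F (Matrix.vecCons (g 0 a) (fun j => g (j + 1) (n' j))) =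
            (F.curryLeft (∑ a ∈ S, g 0 a)) (fun j => g (j + 1) (n' j)) := by
          intro S
          induction S using Finset.induction_on with
          | empty => simp
          | insert a S ha ihS =>
            rw [sum_insert ha, sum_insert ha, ihS, map_add, AlternatingMap.add_apply]; rfl
        exact e' _
      have hb : m 0 ≤ bd n' + 1 := by
        simp only [bd]; split_ifs with h
        · have h1 := hn.1.1 ⟨0, h⟩
          have h2 : m 0 ≤ m (Fin.succ ⟨0, h⟩) := hm (Fin.zero_le _)
          simp only [Fin.tail] at h1; omega
        · have := hT 0; omega
      rw [e, tele _ _ hb, map_sub, AlternatingMap.sub_apply]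
      by_cases hp : 0 < p
      · have : (F.curryLeft (G 0 (bd n' + 1))) (fun j => g (j + 1) (n' j)) = 0 := by
          rw [h2]
          simp only [bd, hp, dif_pos]
          rw [AlternatingMap.curryLeft_apply_apply]
          refine F.map_eq_zero_of_eq _ (i := 0) (j := Fin.succ ⟨0, hp⟩) ?_ ?_
          · simp
          · exact (Fin.succ_ne_zero _).symm
        rw [this, sub_zero]
      · have hp0 : p = 0 := by omega
        have : G 0 (bd n' + 1) = 0 := by
          simp only [bd, hp, dif_neg, not_false_eq_true]
          exact h3 0 (by omega)
        rw [this]; simp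
    rw [sum_congr rfl inner]
    rw [ih (F.curryLeft (G 0 (m 0))) (fun j => g (j + 1)) (fun j => G (j + 1))
      (fun j t => h1 _ _) (fun j t => h2 _ _)
      (fun q hq => h3 (q + 1) (by omega)) (Fin.tail m)
      (fun i j hij => hm (Fin.succ_le_succ_iff.2 hij)) (fun j => hT _)]
    rw [AlternatingMap.curryLeft_apply_apply]
    congr 1; ext j
    refine Fin.cases ?_ (fun j => ?_) j
    · rfl
    · simp [Fin.tail]

end GTP

namespace GTP

open Finset

lemma det_zero_block {p : ℕ} (M : Matrix (Fin p) (Fin p) ℚ) (i0 : Fin p)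
    (h : ∀ i j, i ≤ i0 → i0 ≤ j → M i j = 0) : M.det = 0 := by
  rw [Matrix.det_apply']
  apply sum_eq_zero
  intro σ _
  have : ∃ j, i0 ≤ j ∧ σ j ≤ i0 := by
    by_contra hc
    push Not at hc
    have hsub : (Ici i0).image σ ⊆ Ioi i0 := by
      intro x hx
      simp only [mem_image, mem_Ici] at hx
      obtain ⟨j, hj, rfl⟩ := hx
      exact mem_Ioi.2 (hc j hj)
    have := card_le_card hsub
    rw [card_image_of_injective _ σ.injective, Fin.card_Ici, Fin.card_Ioi] at this
    have := i0.isLt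
    omega
  obtain ⟨j, h1, h2⟩ := this
  rw [prod_eq_zero (f := fun i => M (σ i) i) (mem_univ j) (h _ _ h2 h1), mul_zero]

/-- Kreweras matrix. -/
noncomputable def KM {p : ℕ} (t : ℚ) (μ l : Fin p → ℤ) : Matrix (Fin p) (Fin p) ℚ :=
  Matrix.of fun i j => hh (t + (j : ℕ) - (i : ℕ)) (l i - μ j + (i : ℕ) - (j : ℕ))

/-- Number of chains. -/
noncomputable def Ch {p : ℕ} : ℕ → (Fin p → ℤ) → (Fin p → ℤ) → ℚ
  | 0, μ, l => if μ = l then 1 else 0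
  | n + 1, μ, l => ∑ ν ∈ (Icc μ l).filter Monotone, Ch n ν l

lemma Ch_nonneg {p : ℕ} (n : ℕ) (μ l : Fin p → ℤ) : 0 ≤ Ch n μ l := by
  induction n generalizing μ with
  | zero => simp only [Ch]; split_ifs <;> norm_num
  | succ n ih => simp only [Ch]; exact sum_nonneg fun ν _ => ih ν

lemma det_KM_not_le {p : ℕ} (t : ℚ) {μ l : Fin p → ℤ} (hμ : Monotone μ) (hl : Monotone l)
    (h : ¬ μ ≤ l) : (KM t μ l).det = 0 := by
  rw [Pi.le_def] at h; push Not at h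
  obtain ⟨i0, h0⟩ := h
  apply det_zero_block _ i0
  intro i j hi hj
  apply hh_neg
  have := hμ hj
  have := hl hi
  have : (i : ℕ) ≤ j := hi.trans hj
  omega

lemma KM_zero_entry {p : ℕ} {μ l : Fin p → ℤ} {i j : Fin p} (hij : j ≤ i) (h : μ j < l i) :
    KM 0 μ l i j = 0 := by
  have : (0 : ℚ) + (j : ℕ) - (i : ℕ) = -(((i : ℕ) - (j : ℕ) : ℕ) : ℚ) := by
    rw [Nat.cast_sub hij]; ring
  simp only [KM, Matrix.of_apply]
  rw [this]
  apply hh_vanish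
  have : (j : ℕ) ≤ i := hij
  omega

lemma det_KM_zero {p : ℕ} {μ l : Fin p → ℤ} (hμ : Monotone μ) (hl : Monotone l) :
    (KM 0 μ l).det = if μ = l then 1 else 0 := by
  split_ifs with h
  · subst h
    rw [Matrix.det_of_isLowerTriangular]
    · apply prod_eq_one
      intro i _
      simp [KM, hh_zero]
    · intro i j hij
      apply hh_neg
      have hij : i < j := hij
      have := hμ hij.le
      have : (i : ℕ) < j := hij
      omega
  · by_cases hle : μ ≤ l
    · have hne : (univ.filter fun i => μ i < l i).Nonempty := by
        by_contra hc
        rw [not_nonempty_iff_eq_empty, filter_eq_empty_iff] at hc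
        exact h (le_antisymm hle fun i => not_lt.1 (hc (mem_univ i)))
      obtain ⟨i, hi, hmax⟩ := Finset.exists_maximal hne
      have hi : μ i < l i := by simpa using hi
      apply Matrix.det_eq_zero_of_row_eq_zero i
      intro j
      rcases le_or_gt j i with hj | hj
      · exact KM_zero_entry hj ((hμ hj).trans_lt hi)
      · apply hh_neg
        have : ¬ μ j < l j := by
          intro hc
          exact absurd (hmax (by simpa using hc) hj.le) (not_le.2 hj)
        have := hl hj.le
        have : (i : ℕ) < j := hj
        omega
    · exact det_KM_not_le 0 hμ hl hle

lemma kreweras {p : ℕ} (n : ℕ) {μ l : Fin p → ℤ} (hμ : Monotone μ) (hl : Monotone l) :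
    Ch n μ l = (KM n μ l).det := by
  induction n generalizing μ with
  | zero => rw [Nat.cast_zero, det_KM_zero hμ hl]; rfl
  | succ n ih =>
    by_cases hle : μ ≤ l
    · obtain ⟨T, hT⟩ : ∃ T : ℤ, ∀ i, l i ≤ T :=
        ⟨∑ i, |l i|, fun i => (le_abs_self _).trans
          (single_le_sum (f := fun i => |l i|) (fun i _ => abs_nonneg _) (mem_univ i))⟩
      have key := sum_alt (V := Fin p → ℚ) T p Matrix.detRowAlternating
        (fun j t i => hh ((n : ℚ) + (j : ℕ) - (i : ℕ)) (l i - t + (i : ℕ) - (j : ℕ)))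
        (fun j t i => hh (((n + 1 : ℕ) : ℚ) + (j : ℕ) - (i : ℕ)) (l i - t + (i : ℕ) - (j : ℕ)))
        (by
          intro j t; ext i
          rw [hh_pascal, Pi.sub_apply]
          congr 2 <;> push_cast <;> ring)
        (by
          intro j t; ext i
          congr 1 <;> push_cast <;> ring)
        (by
          intro q hq; ext i
          apply hh_neg
          have := hT i
          have := i.isLt
          omega)
        μ hμ (fun j => (hle j).trans (hT j))
      have tr : ∀ (t : ℚ) (ν : Fin p → ℤ), Matrix.detRowAlternating (R := ℚ) (n := Fin p)
          (fun j i => hh (t + (j : ℕ) - (i : ℕ)) (l i - ν j + (i : ℕ) - (j : ℕ)))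
          = (KM t ν l).det := by
        intro t ν
        rw [← Matrix.det_transpose]; rfl
      simp only [tr] at key
      rw [← key]
      simp only [Ch]
      rw [sum_congr rfl fun ν hν => ih (mem_filter.1 hν).2]
      apply sum_subset
      · intro ν hν
        simp only [mem_filter, mem_Icc] at hν ⊢
        exact ⟨⟨hν.1.1, fun j => (hν.1.2 j).trans (hT j)⟩, hν.2⟩
      · intro ν hν hν'
        simp only [mem_filter, mem_Icc] at hν hν'
        exact det_KM_not_le _ hν.2 hl fun hc => hν' ⟨⟨hν.1.1, hc⟩, hν.2⟩
    · rw [det_KM_not_le _ hμ hl hle, Ch, Icc_eq_empty hle]; rfl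

end GTP

namespace GTP

open Finset Polynomial

noncomputable def hp (c : ℚ) (l : ℤ) : ℚ[X] :=
  if l < 0 then 0 else C ((l.toNat.factorial : ℚ)⁻¹) * ∏ s ∈ range l.toNat, (X + C (c + s))

lemma hp_neg (v : ℚ) {l : ℤ} (h : l < 0) : hp v l = 0 := by simp [hp, h]

lemma eval_hp (x c : ℚ) (l : ℤ) : (hp c l).eval x = hh (x + c) l := by
  unfold hp hh
  split_ifs
  · simp
  · rw [eval_mul, eval_prod, eval_C, div_eq_inv_mul]
    congr 1
    apply prod_congr rfl; intro s _; simp; ring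

lemma hp_sign (q r : ℕ) : 0 ≤ (-1 : ℚ) ^ q * (hp (-(q : ℚ)) ((q + 1 + r : ℕ) : ℤ)).coeff 1 := by
  have h0 : ¬ (((q + 1 + r : ℕ) : ℤ) < 0) := by omega
  unfold hp
  rw [if_neg h0, Int.toNat_natCast, coeff_C_mul, add_assoc, prod_range_add, add_comm 1 r,
    prod_range_succ']
  have e : (X + C (-(q : ℚ) + ((q + 0 : ℕ) : ℚ)) : ℚ[X]) = X := by simp
  rw [e, ← mul_assoc (∏ x ∈ range q, _), show (1 : ℕ) = 0 + 1 from rfl, coeff_mul_X,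
    coeff_zero_eq_eval_zero, eval_mul, eval_prod, eval_prod]
  have e2 : (∏ j ∈ range q, eval (0 : ℚ) (X + C (-(q : ℚ) + (j : ℚ)))) =
      (-1) ^ q * ∏ j ∈ range q, ((q : ℚ) - j) := by
    have e4 : (-1 : ℚ) ^ q = ∏ _j ∈ range q, (-1 : ℚ) := by simp
    rw [e4, ← prod_mul_distrib]
    apply prod_congr rfl; intro j _; simp; ring
  rw [e2]
  have e3 : ∀ a b c d : ℚ, a * (b * (a * c * d)) = (a * a) * (b * (c * d)) := by intros; ring
  rw [e3]
  apply mul_nonneg (mul_self_nonneg _)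
  apply mul_nonneg (by positivity)
  apply mul_nonneg
  · apply prod_nonneg; intro j hj
    have : (j : ℚ) ≤ q := by exact_mod_cast (mem_range.1 hj).le
    linarith
  · apply prod_nonneg; intro j hj
    simp; linarith

/-- The polynomial matrix. -/
noncomputable def PM {p : ℕ} (μ l : Fin p → ℤ) : Matrix (Fin p) (Fin p) ℚ[X] :=
  Matrix.of fun i j => hp (((j : ℕ) : ℚ) - (i : ℕ)) (l i - μ j + (i : ℕ) - (j : ℕ))

noncomputable def DD {p : ℕ} (μ l : Fin p → ℤ) : ℚ[X] := (PM μ l).det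

lemma eval_PM {p : ℕ} (t : ℚ) (μ l : Fin p → ℤ) (i j : Fin p) :
    (PM μ l i j).eval t = KM t μ l i j := by
  simp only [PM, KM, Matrix.of_apply, eval_hp]; congr 1; ring

lemma eval_DD {p : ℕ} (t : ℚ) (μ l : Fin p → ℤ) : (DD μ l).eval t = (KM t μ l).det := by
  rw [DD, ← coe_evalRingHom, RingHom.map_det]; congr 1; ext i j
  exact eval_PM t μ l i j

lemma eval_DD_nat {p : ℕ} (n : ℕ) {μ l : Fin p → ℤ} (hμ : Monotone μ) (hl : Monotone l) :
    (DD μ l).eval (n : ℚ) = Ch n μ l := by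
  rw [eval_DD, kreweras n hμ hl]

lemma coeff_zero_DD {p : ℕ} {μ l : Fin p → ℤ} (hμ : Monotone μ) (hl : Monotone l) :
    (DD μ l).coeff 0 = if μ = l then 1 else 0 := by
  rw [coeff_zero_eq_eval_zero, eval_DD, det_KM_zero hμ hl]

lemma coeff_zero_DD_nonneg {p : ℕ} {μ l : Fin p → ℤ} (hμ : Monotone μ) (hl : Monotone l) :
    0 ≤ (DD μ l).coeff 0 := by
  rw [coeff_zero_DD hμ hl]; split_ifs <;> norm_num

lemma DD_split (a b : ℕ) (μ l : Fin (a + b) → ℤ)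
    (h : ∀ i j, l (Fin.castAdd b i) ≤ μ (Fin.natAdd a j)) :
    DD μ l = DD (fun i => μ (Fin.castAdd b i)) (fun i => l (Fin.castAdd b i)) *
      DD (fun i => μ (Fin.natAdd a i)) (fun i => l (Fin.natAdd a i)) := by
  unfold DD
  rw [← Matrix.det_submatrix_equiv_self finSumFinEquiv, ← Matrix.det_fromBlocks_zero₁₂ _
    (Matrix.of fun i j => PM μ l (Fin.natAdd a i) (Fin.castAdd b j))]
  congr 1
  refine Matrix.ext fun i j => ?_
  rcases i with i | i <;> rcases j with j | j
  · simp [PM]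
  · simp only [PM, Matrix.submatrix_apply, Matrix.of_apply, finSumFinEquiv_apply_left,
      finSumFinEquiv_apply_right, Matrix.fromBlocks_apply₁₂, Matrix.zero_apply]
    apply hp_neg
    have := h i j
    have := i.isLt
    simp only [Fin.val_castAdd, Fin.val_natAdd]
    omega
  · simp [PM]
  · simp only [PM, Matrix.submatrix_apply, Matrix.of_apply,
      finSumFinEquiv_apply_right, Matrix.fromBlocks_apply₂₂, Fin.val_natAdd]
    congr 1 <;> push_cast <;> ring

lemma coeff_one_connected {q : ℕ} {μ l : Fin (q + 1) → ℤ} (hμ : Monotone μ) (hl : Monotone l)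
    (hc : ∀ i : Fin q, μ i.succ < l i.castSucc) (h0 : μ 0 < l (Fin.last q)) :
    0 ≤ (DD μ l).coeff 1 := by
  have hcol : ∀ i, μ 0 < l i := by
    intro i
    refine Fin.lastCases h0 (fun i => ?_) i
    exact (hμ (Fin.zero_le _)).trans_lt (hc i)
  have hrow : ∀ j, μ j < l (Fin.last q) := by
    intro j
    refine Fin.cases h0 (fun j => ?_) j
    exact (hc j).trans_le (hl (Fin.le_last _))
  have hdet0 : ∀ (f g : Fin q → Fin (q + 1)), (((PM μ l).submatrix f g).det).coeff 0 =
      ((KM 0 μ l).submatrix f g).det := by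
    intro f g
    rw [coeff_zero_eq_eval_zero, ← coe_evalRingHom, RingHom.map_det]; congr 1; ext i j
    exact eval_PM 0 μ l _ _
  rw [DD, Matrix.det_succ_column_zero, finsetSum_coeff, sum_eq_single (Fin.last q)]
  · rw [mul_assoc]
    have e1 : ((-1 : ℚ[X]) ^ ((Fin.last q : Fin (q + 1)) : ℕ)) = C ((-1) ^ q) := by simp
    rw [e1, coeff_C_mul, mul_coeff_one]
    have e2 : (PM μ l (Fin.last q) 0).coeff 0 = 0 := by
      rw [coeff_zero_eq_eval_zero, eval_PM]; exact KM_zero_entry (Fin.zero_le _) h0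
    rw [e2, zero_mul, zero_add, hdet0, Matrix.det_of_isUpperTriangular, prod_eq_one]
    · rw [mul_one]
      have h00 := h0
      obtain ⟨r, hr⟩ : ∃ r : ℕ, l (Fin.last q) - μ 0 = r + 1 :=
        ⟨(l (Fin.last q) - μ 0 - 1).toNat, by omega⟩
      have := hp_sign q r
      simp only [PM, Matrix.of_apply]
      convert this using 4
      · simp
      · simp; omega
    · intro j _
      simp only [Fin.succAbove_last, Matrix.submatrix_apply, KM, Matrix.of_apply]
      have e3 : (0 : ℚ) + ((j.succ : Fin (q + 1)) : ℕ) - ((j.castSucc : Fin (q + 1)) : ℕ) = 1 := by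
        simp
      rw [e3]
      apply hh_one
      have := hc j
      simp; omega
    · intro i j hij
      have hij : j < i := hij
      simp only [Fin.succAbove_last, Matrix.submatrix_apply]
      apply KM_zero_entry
      · exact Fin.succ_le_castSucc_iff.2 hij
      · exact (hc j).trans_le (hl (Fin.castSucc_le_castSucc_iff.2 hij.le))
  · intro i _ hi
    rw [mul_assoc]
    have e1 : ((-1 : ℚ[X]) ^ (i : ℕ)) = C ((-1) ^ (i : ℕ)) := by simp
    rw [e1, coeff_C_mul, mul_coeff_one]
    have e2 : (PM μ l i 0).coeff 0 = 0 := by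
      rw [coeff_zero_eq_eval_zero, eval_PM]; exact KM_zero_entry (Fin.zero_le _) (hcol i)
    obtain ⟨i', hi'⟩ : ∃ i', i.succAbove i' = Fin.last q :=
      Fin.exists_succAbove_eq (Ne.symm hi)
    rw [e2, zero_mul, zero_add, hdet0, Matrix.det_eq_zero_of_row_eq_zero i']
    · simp
    · intro j
      rw [Matrix.submatrix_apply, hi']
      exact KM_zero_entry (Fin.le_last _) (hrow _)
  · simp

lemma coeff_one_nonneg (p : ℕ) : ∀ {μ l : Fin p → ℤ} (_ : Monotone μ) (_ : Monotone l)
    (_ : μ ≤ l), 0 ≤ (DD μ l).coeff 1 := by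
  induction p using Nat.strong_induction_on with
  | _ p ih =>
  intro μ l hμ hl hle
  rcases p with _ | q
  · simp [DD, coeff_one]
  by_cases hd : ∃ i : Fin q, l i.castSucc ≤ μ i.succ
  · obtain ⟨i, hi⟩ := hd
    have : ∃ a b : ℕ, a = (i : ℕ) + 1 ∧ a + b = q + 1 ∧ 0 < b :=
      ⟨i + 1, q - i, rfl, by omega, by omega⟩
    obtain ⟨a, b, ha, hab, hb⟩ := this
    have hsp : ∀ (i' : Fin a) (j : Fin b), l (Fin.cast hab (Fin.castAdd b i')) ≤
        μ (Fin.cast hab (Fin.natAdd a j)) := by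
      intro i' j
      refine (hl ?_).trans (hi.trans (hμ ?_))
      · simp [Fin.le_def]; omega
      · simp [Fin.le_def]; omega
    clear hi
    have ha' : 0 < a := by omega
    clear ha i
    have key : ∀ (P : ℕ) (hP : a + b = P) (μ l : Fin P → ℤ), Monotone μ → Monotone l → μ ≤ l →
        (∀ (i' : Fin a) (j : Fin b), l (Fin.cast hP (Fin.castAdd b i')) ≤
        μ (Fin.cast hP (Fin.natAdd a j))) → 0 ≤ (DD μ l).coeff 1 := by
      intro P hP; subst hP
      intro μ l hμ hl hle hsp
      have m1 : Monotone fun i : Fin a => Fin.castAdd b i := fun x y h => h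
      have m2 : Monotone fun i : Fin b => Fin.natAdd a i := fun x y h => by
        simp only [Fin.le_def, Fin.val_natAdd] at *; omega
      rw [DD_split a b μ l hsp, mul_coeff_one]
      exact add_nonneg
        (mul_nonneg (coeff_zero_DD_nonneg (hμ.comp m1) (hl.comp m1))
          (ih b (by omega) (hμ.comp m2) (hl.comp m2) (fun i => hle _)))
        (mul_nonneg (ih a (by omega) (hμ.comp m1) (hl.comp m1) (fun i => hle _))
          (coeff_zero_DD_nonneg (hμ.comp m2) (hl.comp m2)))
    exact key _ hab μ l hμ hl hle hsp
  · push Not at hd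
    by_cases h0 : μ 0 < l (Fin.last q)
    · exact coeff_one_connected hμ hl hd h0
    · rcases q with _ | q
      · have : l 0 = μ 0 := le_antisymm (not_lt.1 h0) (hle 0)
        simp [DD, PM, this, hp, coeff_one]
      · exfalso; apply h0
        exact (hμ (Fin.zero_le _)).trans_lt ((hd 0).trans_le (hl (Fin.le_last _)))

end GTP

namespace GTP

open Finset Polynomial

lemma Ch_not_le {p : ℕ} (n : ℕ) {μ l : Fin p → ℤ} (h : ¬ μ ≤ l) : Ch n μ l = 0 := by
  cases n with
  | zero => simp only [Ch]; rw [if_neg]; rintro rfl; exact h le_rfl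
  | succ n => rw [Ch, Icc_eq_empty h]; rfl

lemma Ch_add {p : ℕ} (a b : ℕ) {μ l : Fin p → ℤ} (hμ : Monotone μ) :
    Ch (a + b) μ l = ∑ ν ∈ (Icc μ l).filter Monotone, Ch a μ ν * Ch b ν l := by
  induction a generalizing μ with
  | zero =>
    simp only [Ch, ite_mul, one_mul, zero_mul, zero_add]
    rw [sum_ite_eq]
    split_ifs with h
    · rfl
    · apply Ch_not_le
      intro hc; exact h (by simp [hc, hμ])
  | succ a ih =>
    rw [show a + 1 + b = (a + b) + 1 by ring]
    simp only [Ch]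
    rw [sum_congr rfl fun ν hν => ih (mem_filter.1 hν).2]
    simp only [sum_mul]
    apply sum_comm'
    intro x y
    simp only [mem_filter, mem_Icc]
    constructor
    · rintro ⟨⟨⟨h1, h2⟩, h3⟩, ⟨h4, h5⟩, h6⟩
      exact ⟨⟨⟨h1, h4⟩, h3⟩, ⟨h1.trans h4, h5⟩, h6⟩
    · rintro ⟨⟨⟨h1, h2⟩, h3⟩, ⟨h4, h5⟩, h6⟩
      exact ⟨⟨⟨h1, h2.trans h5⟩, h3⟩, ⟨h2, h5⟩, h6⟩

lemma poly_ext_nat {P Q : ℚ[X]} (h : ∀ n : ℕ, P.eval (n : ℚ) = Q.eval (n : ℚ)) : P = Q := by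
  apply eq_of_infinite_eval_eq
  refine Set.infinite_of_injective_forall_mem (f := fun n : ℕ => (n : ℚ)) Nat.cast_injective ?_
  intro n; exact h n

lemma derivative_DD {p : ℕ} {μ l : Fin p → ℤ} (hμ : Monotone μ) (hl : Monotone l) :
    derivative (DD μ l) = ∑ ν ∈ (Icc μ l).filter Monotone, C ((DD μ ν).coeff 1) * DD ν l := by
  apply poly_ext_nat
  intro b
  have key : (DD μ l).comp (X + C (b : ℚ)) =
      ∑ ν ∈ (Icc μ l).filter Monotone, DD μ ν * C (Ch b ν l) := by
    apply poly_ext_nat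
    intro a
    rw [eval_comp, eval_finsetSum]
    have e : eval (a : ℚ) (X + C (b : ℚ)) = ((a + b : ℕ) : ℚ) := by simp
    rw [e, eval_DD_nat _ hμ hl, Ch_add a b hμ]
    apply sum_congr rfl; intro ν hν
    rw [eval_mul, eval_C, eval_DD_nat _ hμ (mem_filter.1 hν).2]
  have := congrArg (fun P => (derivative P).eval 0) key
  simp only [derivative_comp, derivative_sum, eval_finsetSum] at this
  simp only [derivative_mul, derivative_C, mul_zero, add_zero, eval_mul, eval_C, eval_comp,
    eval_add, eval_X, zero_add, derivative_add, derivative_X, one_mul] at this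
  rw [this, eval_finsetSum]
  apply sum_congr rfl; intro ν hν
  rw [eval_mul, eval_C, eval_DD_nat _ (mem_filter.1 hν).2 hl, ← coeff_zero_eq_eval_zero,
    coeff_derivative]
  simp

lemma coeff_DD_nonneg {p : ℕ} (r : ℕ) {μ l : Fin p → ℤ} (hμ : Monotone μ) (hl : Monotone l) :
    0 ≤ (DD μ l).coeff r := by
  induction r generalizing μ with
  | zero => exact coeff_zero_DD_nonneg hμ hl
  | succ r ih =>
    have h := congrArg (fun P => coeff P r) (derivative_DD hμ hl)
    simp only [coeff_derivative, finsetSum_coeff, coeff_C_mul] at h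
    have h2 : 0 ≤ (DD μ l).coeff (r + 1) * ((r : ℚ) + 1) := by
      rw [h]
      apply sum_nonneg; intro ν hν
      simp only [mem_filter, mem_Icc] at hν
      exact mul_nonneg (coeff_one_nonneg p hμ hν.2 hν.1.1) (ih hν.2)
    exact nonneg_of_mul_nonneg_left h2 (by positivity)

/-- Functions given by polynomials with nonnegative coefficients. -/
def PP (f : ℕ → ℚ) : Prop :=
  ∃ P : ℚ[X], (∀ i, 0 ≤ P.coeff i) ∧ ∀ n : ℕ, 1 ≤ n → P.eval (n : ℚ) = f n

lemma PP_Ch {p : ℕ} {μ l : Fin p → ℤ} (hμ : Monotone μ) (hl : Monotone l) :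
    PP (fun n => Ch n μ l) :=
  ⟨DD μ l, fun r => coeff_DD_nonneg r hμ hl, fun n _ => eval_DD_nat n hμ hl⟩

lemma PP.mul {f g : ℕ → ℚ} (hf : PP f) (hg : PP g) : PP (fun n => f n * g n) := by
  obtain ⟨P, hP, hP'⟩ := hf
  obtain ⟨Q, hQ, hQ'⟩ := hg
  refine ⟨P * Q, fun i => ?_, fun n hn => by simp [hP' n hn, hQ' n hn]⟩
  rw [coeff_mul]
  exact sum_nonneg fun x _ => mul_nonneg (hP _) (hQ _)

lemma PP.const {c : ℚ} (h : 0 ≤ c) : PP (fun _ => c) := by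
  refine ⟨C c, fun i => ?_, fun n _ => by simp⟩
  rw [coeff_C]; split_ifs <;> simp [h]

lemma PP.sum {ι : Type*} (s : Finset ι) {f : ι → ℕ → ℚ} (h : ∀ i ∈ s, PP (f i)) :
    PP (fun n => ∑ i ∈ s, f i n) := by
  classical
  choose! P hP hP' using h
  refine ⟨∑ i ∈ s, P i, fun r => ?_, fun n hn => ?_⟩
  · rw [finsetSum_coeff]; exact sum_nonneg fun i hi => hP i hi r
  · rw [eval_finsetSum]; exact sum_congr rfl fun i hi => hP' i hi n hn

lemma PP.congr {f g : ℕ → ℚ} (hf : PP f) (h : ∀ n, 1 ≤ n → f n = g n) : PP g := by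
  obtain ⟨P, hP, hP'⟩ := hf
  exact ⟨P, hP, fun n hn => (hP' n hn).trans (h n hn)⟩

end GTP

namespace GTP

open Finset

/-- Upper-type conditions on a state. -/
structure Up (k m : ℕ) (zt yt : Fin k → ℕ) (s : ℕ) (c : Fin k → ℤ) : Prop where
  nonneg : ∀ i, 0 ≤ c i
  le : ∀ i, c i ≤ m
  a : ∀ i, s < zt i → c i = 0
  cc : ∀ (i : Fin k) (hi : (i : ℕ) + 1 < k),
    c ⟨i + 1, hi⟩ ≤ 0 ∨ c ⟨i + 1, hi⟩ < c i ∨ c i = m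
  e : ∀ (i : Fin k) (hi : (i : ℕ) + 1 < k), c ⟨i + 1, hi⟩ = m → yt i ≤ s

/-- Allowed states at time `s`. -/
structure Al (k m : ℕ) (zt yt : Fin k → ℕ) (s : ℕ) (c : Fin k → ℤ) : Prop
    extends Up k m zt yt s c where
  b : ∀ i, yt i ≤ s → c i = m
  d : ∀ (i : Fin k) (hi : (i : ℕ) + 1 < k), zt ⟨i + 1, hi⟩ ≤ s → 0 < c i

section
variable {k m : ℕ} {zt yt : Fin k → ℕ} {s : ℕ}

lemma Up.succ {c : Fin k → ℤ} (h : Up k m zt yt s c) : Up k m zt yt (s + 1) c :=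
  ⟨h.nonneg, h.le, fun i hi => h.a i (by omega), h.cc, fun i hi hh => (h.e i hi hh).trans (by omega)⟩

lemma Up.zero (hm : 0 < m) : Up k m zt yt s 0 :=
  ⟨fun i => le_rfl, fun i => by simp, fun i _ => rfl, fun i hi => Or.inl le_rfl,
    fun i hi h => by simp at h; omega⟩

lemma Al.inf {c d : Fin k → ℤ} (hc : Al k m zt yt s c) (hd : Al k m zt yt s d) :
    Al k m zt yt s (c ⊓ d) := by
  refine ⟨⟨fun i => ?_, fun i => ?_, fun i h => ?_, fun i h => ?_, fun i h h' => ?_⟩, fun i h => ?_,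
    fun i h h' => ?_⟩ <;> simp only [Pi.inf_apply] at *
  · have := hc.nonneg i; have := hd.nonneg i; omega
  · have := hc.le i; have := hd.le i; omega
  · have := hc.a i h; have := hd.a i h; omega
  · have := hc.cc i h; have := hd.cc i h
    have := hc.le i; have := hd.le i
    have := hc.le ⟨i + 1, h⟩; have := hd.le ⟨i + 1, h⟩
    by_cases h1 : c ⟨i + 1, h⟩ = m
    · have := hc.b i (hc.e i h h1); have := hd.b i (hc.e i h h1); omega
    by_cases h2 : d ⟨i + 1, h⟩ = m
    · have := hc.b i (hd.e i h h2); have := hd.b i (hd.e i h h2); omega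
    omega
  · apply hc.e i h
    have := hc.le ⟨i + 1, h⟩; omega
  · have := hc.b i h; have := hd.b i h; omega
  · have := hc.d i h h'; have := hd.d i h h'; omega

lemma Up.sup {c d : Fin k → ℤ} (hc : Up k m zt yt s c) (hd : Al k m zt yt s d) :
    Al k m zt yt s (c ⊔ d) := by
  refine ⟨⟨fun i => ?_, fun i => ?_, fun i h => ?_, fun i h => ?_, fun i h h' => ?_⟩, fun i h => ?_,
    fun i h h' => ?_⟩ <;> simp only [Pi.sup_apply] at *
  · have := hc.nonneg i; have := hd.nonneg i; omega
  · have := hc.le i; have := hd.le i; omega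
  · have := hc.a i h; have := hd.a i h; omega
  · have := hc.cc i h; have := hd.cc i h
    have := hc.le i; have := hd.le i
    omega
  · rcases max_choice (c ⟨i + 1, h⟩) (d ⟨i + 1, h⟩) with h1 | h1
    · exact hc.e i h (h1.symm.trans h')
    · exact hd.e i h (h1.symm.trans h')
  · have := hc.le i; have := hd.b i h; omega
  · have := hd.d i h h'; omega

/-- The finite set of all states. -/
noncomputable def St (k m : ℕ) : Finset (Fin k → ℤ) := Icc 0 (fun _ => (m : ℤ))

lemma Up.mem_St {c : Fin k → ℤ} (h : Up k m zt yt s c) : c ∈ St k m :=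
  mem_Icc.2 ⟨h.nonneg, h.le⟩

open Classical in
lemma exists_least (h : ∃ c, Al k m zt yt s c) :
    ∃ c, Al k m zt yt s c ∧ ∀ d, Al k m zt yt s d → c ≤ d := by
  have hne : ((St k m).filter (Al k m zt yt s)).Nonempty := by
    obtain ⟨c, hc⟩ := h
    exact ⟨c, by simp [hc, hc.toUp.mem_St]⟩
  refine ⟨((St k m).filter (Al k m zt yt s)).inf' hne id, ?_, ?_⟩
  · exact Finset.inf'_induction (p := Al k m zt yt s) hne id (fun a ha b hb => ha.inf hb)
      (fun c hc => (mem_filter.1 hc).2)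
  · intro d hd
    exact Finset.inf'_le id (by simp [hd, hd.toUp.mem_St])

lemma exists_J (h : ∃ c, Al k m zt yt s c) {c : Fin k → ℤ} (hc : Up k m zt yt s c) :
    ∃ d, Al k m zt yt s d ∧ ∀ c', Al k m zt yt s c' → (c ≤ c' ↔ d ≤ c') := by
  obtain ⟨e, he, hl⟩ := exists_least h
  refine ⟨c ⊔ e, hc.sup he, fun c' hc' => ?_⟩
  rw [sup_le_iff]
  exact ⟨fun h => ⟨h, hl _ hc'⟩, fun h => h.1⟩

/-- Encoding of states as partitions. -/
def phi (k m : ℕ) (zt yt : Fin k → ℕ) (s : ℕ) (c : Fin k → ℤ) (i : Fin k) : ℤ :=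
  if yt i ≤ s then -((m : ℤ) + k) else if zt i ≤ s then -(c i + (i : ℕ)) else 0

/-- Inverse of the encoding. -/
def psi (k m : ℕ) (zt yt : Fin k → ℕ) (s : ℕ) (ν : Fin k → ℤ) (i : Fin k) : ℤ :=
  if yt i ≤ s then (m : ℤ) else if zt i ≤ s then -ν i - (i : ℕ) else 0

lemma mono_of_succ {f : Fin k → ℤ}
    (h : ∀ (i : Fin k) (hi : (i : ℕ) + 1 < k), f i ≤ f ⟨i + 1, hi⟩) : Monotone f := by
  have : ∀ (n : ℕ) (i : Fin k) (hi : (i : ℕ) + n < k), f i ≤ f ⟨i + n, hi⟩ := by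
    intro n
    induction n with
    | zero => intro i hi; exact le_rfl
    | succ n ih => intro i hi; exact (ih i (by omega)).trans (h ⟨i + n, by omega⟩ hi)
  intro i j hij
  have hij' : (i : ℕ) ≤ j := hij
  have := this (j - i) i (by omega)
  have e : (⟨i + (j - i), by omega⟩ : Fin k) = j := by ext; simp; omega
  rwa [e] at this

lemma phi_mono (hz : Monotone zt) (hy : Monotone yt) {c : Fin k → ℤ} (hc : Al k m zt yt s c) :
    Monotone (phi k m zt yt s c) := by
  apply mono_of_succ
  intro i hi
  have hle : i ≤ ⟨i + 1, hi⟩ := by simp [Fin.le_def]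
  have h1 := hz hle
  have h2 := hy hle
  have h3 := hc.cc i hi
  have h4 := hc.le i
  have h5 := hc.le ⟨i + 1, hi⟩
  have h6 := hc.e i hi
  have h7 := hc.d i hi
  have h8 := hc.nonneg i
  have h9 := hc.nonneg ⟨i + 1, hi⟩
  simp only [phi]
  push_cast
  split_ifs <;> omega

lemma phi_le_iff {c c' : Fin k → ℤ} (hc : Al k m zt yt s c) (hc' : Al k m zt yt s c') :
    phi k m zt yt s c' ≤ phi k m zt yt s c ↔ c ≤ c' := by
  simp only [Pi.le_def]
  apply forall_congr'
  intro i
  have h1 := hc.a i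
  have h2 := hc'.a i
  have h3 := hc.b i
  have h4 := hc'.b i
  simp only [phi]
  split_ifs <;> omega

lemma phi_inj {c c' : Fin k → ℤ} (hc : Al k m zt yt s c) (hc' : Al k m zt yt s c')
    (h : phi k m zt yt s c' = phi k m zt yt s c) : c = c' :=
  le_antisymm ((phi_le_iff hc hc').1 h.le) ((phi_le_iff hc' hc).1 h.ge)

lemma psi_spec (hm : 0 < m) (hz : Monotone zt) (hy : Monotone yt) {c c' ν : Fin k → ℤ}
    (hc : Al k m zt yt s c) (hc' : Al k m zt yt s c') (hν : Monotone ν)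
    (h1 : phi k m zt yt s c' ≤ ν) (h2 : ν ≤ phi k m zt yt s c) :
    Al k m zt yt s (psi k m zt yt s ν) ∧ phi k m zt yt s (psi k m zt yt s ν) = ν := by
  have hcd : ∀ i, c i ≤ psi k m zt yt s ν i ∧ psi k m zt yt s ν i ≤ c' i := by
    intro i
    have := h1 i
    have := h2 i
    have := hc.a i
    have := hc.b i
    have := hc'.a i
    have := hc'.b i
    have := hc'.nonneg i
    simp only [phi, psi] at *
    split_ifs at * <;> omega
  refine ⟨⟨⟨fun i => ?_, fun i => ?_, fun i h => ?_, fun i h => ?_, fun i h h' => ?_⟩, fun i h => ?_,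
    fun i h h' => ?_⟩, ?_⟩
  · exact (hc.nonneg i).trans (hcd i).1
  · exact (hcd i).2.trans (hc'.le i)
  · have := hcd i; have := hc.a i h; have := hc'.a i h; omega
  · have hle : i ≤ ⟨i + 1, h⟩ := by simp [Fin.le_def]
    have := hz hle
    have := hy hle
    have := hν hle
    simp only [psi]
    push_cast
    split_ifs <;> omega
  · apply hc'.e i h
    have := hcd ⟨i + 1, h⟩; have := hc'.le ⟨i + 1, h⟩; omega
  · have := hcd i; have := hc.b i h; have := hc'.b i h; omega
  · have := hc.d i h h'; have := hcd i; omega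
  · ext i
    have := h1 i
    have := h2 i
    simp only [phi, psi] at *
    split_ifs at * <;> omega

open Classical in
lemma Ch_one_eq {p : ℕ} {μ l : Fin p → ℤ} (hl : Monotone l) :
    Ch 1 μ l = if μ ≤ l then 1 else 0 := by
  simp only [Ch]
  rw [sum_ite_eq']
  simp [hl]

open Classical in
/-- One transfer step. -/
noncomputable def step (k m : ℕ) (A : (Fin k → ℤ) → Prop) (u : (Fin k → ℤ) → ℚ)
    (c' : Fin k → ℤ) : ℚ :=
  if A c' then ∑ c ∈ (St k m).filter (· ≤ c'), u c else 0

open Classical in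
lemma step_iterate (hm : 0 < m) (hz : Monotone zt) (hy : Monotone yt)
    (J : (Fin k → ℤ) → (Fin k → ℤ))
    (hJ : ∀ c, Up k m zt yt s c → Al k m zt yt s (J c) ∧
      ∀ c', Al k m zt yt s c' → (c ≤ c' ↔ J c ≤ c'))
    (u : (Fin k → ℤ) → ℚ) (hu : ∀ c, ¬ Up k m zt yt s c → u c = 0) (n : ℕ) :
    ∀ c', Al k m zt yt s c' → ((step k m (Al k m zt yt s))^[n + 1] u) c' =
      ∑ c ∈ (St k m).filter (Up k m zt yt s),
        u c * Ch (n + 1) (phi k m zt yt s c') (phi k m zt yt s (J c)) := by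
  induction n with
  | zero =>
    intro c' hc'
    simp only [zero_add, Function.iterate_one, step, if_pos hc']
    rw [sum_filter, sum_filter]
    apply sum_congr rfl
    intro c _
    by_cases hc : Up k m zt yt s c
    · obtain ⟨h1, h2⟩ := hJ c hc
      rw [if_pos hc, Ch_one_eq (phi_mono hz hy h1)]
      simp only [phi_le_iff h1 hc', ← h2 c' hc']
      split_ifs <;> simp
    · rw [if_neg hc, hu c hc]; simp
  | succ n ih =>
    intro c' hc'
    rw [Function.iterate_succ_apply', step, if_pos hc']
    have e1 : ∑ c ∈ (St k m).filter (· ≤ c'), ((step k m (Al k m zt yt s))^[n + 1] u) c =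
        ∑ c ∈ (St k m).filter (fun c => c ≤ c' ∧ Al k m zt yt s c),
          ∑ e ∈ (St k m).filter (Up k m zt yt s),
            u e * Ch (n + 1) (phi k m zt yt s c) (phi k m zt yt s (J e)) := by
      rw [← filter_filter, sum_filter (Al k m zt yt s)]
      apply sum_congr rfl
      intro c _
      split_ifs with h
      · exact ih c h
      · rw [Function.iterate_succ_apply', step, if_neg h]
    rw [e1, sum_comm]
    apply sum_congr rfl
    intro e he
    obtain ⟨h1, h2⟩ := hJ e (mem_filter.1 he).2
    rw [← mul_sum]
    refine congrArg (u e * ·) ?_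
    have e3 : ∀ μ l : Fin k → ℤ, Ch (n + 1 + 1) μ l =
        ∑ ν ∈ (Icc μ l).filter Monotone, Ch (n + 1) ν l := fun μ l => rfl
    rw [e3]
    have e2 : ∑ c ∈ (St k m).filter (fun c => c ≤ c' ∧ Al k m zt yt s c),
        Ch (n + 1) (phi k m zt yt s c) (phi k m zt yt s (J e)) =
        ∑ c ∈ (St k m).filter (fun c => (c ≤ c' ∧ Al k m zt yt s c) ∧ J e ≤ c),
        Ch (n + 1) (phi k m zt yt s c) (phi k m zt yt s (J e)) := by
      symm
      apply sum_subset
      · intro c hc; simp only [mem_filter] at hc ⊢; exact ⟨hc.1, hc.2.1⟩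
      · intro c hc hc2
        simp only [mem_filter] at hc hc2
        apply Ch_not_le
        rw [phi_le_iff h1 hc.2.2]
        intro h; exact hc2 ⟨hc.1, hc.2, h⟩
    rw [e2]
    apply sum_nbij' (phi k m zt yt s) (psi k m zt yt s)
    · intro c hc
      simp only [mem_filter, mem_Icc] at hc ⊢
      obtain ⟨_, ⟨h3, h4⟩, h5⟩ := hc
      exact ⟨⟨(phi_le_iff h4 hc').2 h3, (phi_le_iff h1 h4).2 h5⟩, phi_mono hz hy h4⟩
    · intro ν hν
      simp only [mem_filter, mem_Icc] at hν ⊢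
      obtain ⟨h3, h4⟩ := psi_spec hm hz hy h1 hc' hν.2 hν.1.1 hν.1.2
      refine ⟨h3.toUp.mem_St, ⟨?_, h3⟩, ?_⟩
      · rw [← phi_le_iff h3 hc', h4]; exact hν.1.1
      · rw [← phi_le_iff h1 h3, h4]; exact hν.1.2
    · intro c hc
      simp only [mem_filter] at hc
      obtain ⟨_, ⟨h3, h4⟩, h5⟩ := hc
      obtain ⟨h6, h7⟩ := psi_spec hm hz hy h1 hc' (phi_mono hz hy h4) ((phi_le_iff h4 hc').2 h3)
        ((phi_le_iff h1 h4).2 h5)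
      exact (phi_inj h4 h6 h7).symm
    · intro ν hν
      simp only [mem_filter, mem_Icc] at hν
      exact (psi_spec hm hz hy h1 hc' hν.2 hν.1.1 hν.1.2).2
    · intro c _; rfl

open Classical in
/-- Weights after `s` blocks of length `n`. -/
noncomputable def bb (k m : ℕ) (zt yt : Fin k → ℕ) (n : ℕ) : ℕ → (Fin k → ℤ) → ℚ
  | 0, c => if c = 0 then 1 else 0
  | s + 1, c => ((step k m (Al k m zt yt s))^[n] (bb k m zt yt n s)) c

lemma bb_supp (hm : 0 < m) (n : ℕ) (hn : 1 ≤ n) (s : ℕ) (c : Fin k → ℤ)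
    (h : ¬ Up k m zt yt s c) : bb k m zt yt n s c = 0 := by
  cases s with
  | zero =>
    rw [bb, if_neg]; rintro rfl; exact h (Up.zero hm)
  | succ s =>
    obtain ⟨n, rfl⟩ : ∃ n', n = n' + 1 := ⟨n - 1, by omega⟩
    rw [bb, Function.iterate_succ_apply', step, if_neg]
    intro h'; exact h h'.toUp.succ

open Classical in
lemma PP_bb (hm : 0 < m) (hz : Monotone zt) (hy : Monotone yt) (s : ℕ) (c' : Fin k → ℤ) :
    PP (fun n => bb k m zt yt n s c') := by
  induction s generalizing c' with
  | zero =>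
    simp only [bb]
    exact PP.const (by split_ifs <;> norm_num)
  | succ s ih =>
    by_cases hc' : Al k m zt yt s c'
    · have hJ : ∀ c, ∃ d, Up k m zt yt s c → Al k m zt yt s d ∧
          ∀ c', Al k m zt yt s c' → (c ≤ c' ↔ d ≤ c') := by
        intro c
        by_cases hc : Up k m zt yt s c
        · obtain ⟨d, hd⟩ := exists_J ⟨c', hc'⟩ hc
          exact ⟨d, fun _ => hd⟩
        · exact ⟨0, fun h => absurd h hc⟩
      choose J hJ using hJ
      refine PP.congr (f := fun n => ∑ c ∈ (St k m).filter (Up k m zt yt s),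
        bb k m zt yt n s c * Ch n (phi k m zt yt s c') (phi k m zt yt s (J c))) ?_ ?_
      · apply PP.sum
        intro c hc
        apply PP.mul (ih c)
        exact PP_Ch (phi_mono hz hy hc') (phi_mono hz hy (hJ c (mem_filter.1 hc).2).1)
      · intro n hn
        obtain ⟨n, rfl⟩ : ∃ n', n = n' + 1 := ⟨n - 1, by omega⟩
        rw [bb, step_iterate hm hz hy J hJ _ (fun c h => bb_supp hm _ hn s c h) n c' hc']
    · refine PP.congr (PP.const le_rfl) ?_
      intro n hn
      obtain ⟨n, rfl⟩ : ∃ n', n = n' + 1 := ⟨n - 1, by omega⟩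
      rw [bb, Function.iterate_succ_apply', step, if_neg hc']

end

end GTP

namespace GTP

open Finset

section
variable {k m : ℕ}

open Classical in
/-- Weights for a general sequence of allowed sets. -/
noncomputable def ww (k m : ℕ) (A : ℕ → (Fin k → ℤ) → Prop) : ℕ → (Fin k → ℤ) → ℚ
  | 0, c => if c = 0 then 1 else 0
  | v + 1, c => step k m (A v) (ww k m A v) c

open Classical in
/-- Monotone sequences of allowed states bounded by `c`. -/
noncomputable def Sq (k m : ℕ) (A : ℕ → (Fin k → ℤ) → Prop) (v : ℕ) (c : Fin k → ℤ) :
    Finset (Fin v → Fin k → ℤ) :=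
  (Fintype.piFinset fun _ => St k m).filter
    fun f => Monotone f ∧ (∀ i : Fin v, A i (f i)) ∧ ∀ i, f i ≤ c

lemma mem_Sq {A : ℕ → (Fin k → ℤ) → Prop} {v : ℕ} {c : Fin k → ℤ} {f : Fin v → Fin k → ℤ} :
    f ∈ Sq k m A v c ↔ (∀ i, f i ∈ St k m) ∧ Monotone f ∧ (∀ i : Fin v, A i (f i)) ∧
      ∀ i, f i ≤ c := by
  simp [Sq]

open Classical in
lemma card_Sq_succ (A : ℕ → (Fin k → ℤ) → Prop) (v : ℕ) (c : Fin k → ℤ) :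
    (Sq k m A (v + 1) c).card =
      ∑ c' ∈ (St k m).filter (fun c' => c' ≤ c ∧ A v c'), (Sq k m A v c').card := by
  rw [← card_sigma]
  apply card_nbij' (fun f => ⟨f (Fin.last v), Fin.init f⟩)
    (fun x => Fin.snoc (α := fun _ => Fin k → ℤ) x.2 x.1)
  · intro f hf
    simp only [SetLike.mem_coe, mem_sigma, mem_filter, mem_Sq] at hf ⊢
    obtain ⟨h1, h2, h3, h4⟩ := hf
    refine ⟨⟨h1 _, h4 _, by simpa using h3 (Fin.last v)⟩, fun i => h1 _, ?_, ?_, ?_⟩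
    · intro i j hij; exact h2 (Fin.castSucc_le_castSucc_iff.2 hij)
    · intro i; exact h3 i.castSucc
    · intro i; exact h2 (Fin.le_last _)
  · rintro ⟨c', g⟩ hg
    simp only [SetLike.mem_coe, mem_sigma, mem_filter, mem_Sq] at hg ⊢
    obtain ⟨⟨h1, h2, h3⟩, h4, h5, h6, h7⟩ := hg
    refine ⟨?_, ?_, ?_, ?_⟩
    · intro i; refine Fin.lastCases ?_ (fun i => ?_) i
      · simpa using h1
      · simpa using h4 i
    · intro i j
      refine Fin.lastCases ?_ (fun i => ?_) i <;> refine Fin.lastCases ?_ (fun j => ?_) j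
      · simp
      · intro h; exact absurd h (not_le.2 (Fin.castSucc_lt_last j))
      · intro _; simpa using h7 i
      · intro h; simpa using h5 (Fin.castSucc_le_castSucc_iff.1 h)
    · intro i; refine Fin.lastCases ?_ (fun i => ?_) i
      · simpa using h3
      · simpa using h6 i
    · intro i; refine Fin.lastCases ?_ (fun i => ?_) i
      · simpa using h2
      · simpa using (h7 i).trans h2
  · intro f _; exact Fin.snoc_init_self f
  · rintro ⟨c', g⟩ _; simp

open Classical in
lemma sum_ww (A : ℕ → (Fin k → ℤ) → Prop) (v : ℕ) (c : Fin k → ℤ) (hc : 0 ≤ c) :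
    ∑ c' ∈ (St k m).filter (· ≤ c), ww k m A v c' = ((Sq k m A v c).card : ℚ) := by
  induction v generalizing c with
  | zero =>
    have : Sq k m A 0 c = univ := by
      ext f; simp only [mem_Sq, mem_univ, iff_true]
      exact ⟨fun i => i.elim0, fun i => i.elim0, fun i => i.elim0, fun i => i.elim0⟩
    rw [this]
    simp only [ww]
    rw [sum_ite_eq']
    simpa [St, Pi.le_def] using hc
  | succ v ih =>
    rw [card_Sq_succ, Nat.cast_sum, ← filter_filter, sum_filter (A v)]
    apply sum_congr rfl
    intro c' hc'
    simp only [ww, step]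
    split_ifs
    · apply ih
      exact (mem_Icc.1 (mem_filter.1 hc').1).1
    · rfl

lemma bb_eq_ww {zt yt : Fin k → ℕ} (n : ℕ) (hn : 1 ≤ n) (s : ℕ) :
    bb k m zt yt n s = ww k m (fun v => Al k m zt yt (v / n)) (n * s) := by
  induction s with
  | zero => ext c; simp only [bb, Nat.mul_zero, ww]
  | succ s ih =>
    have : ∀ r ≤ n, (step k m (Al k m zt yt s))^[r] (bb k m zt yt n s) =
        ww k m (fun v => Al k m zt yt (v / n)) (n * s + r) := by
      intro r
      induction r with
      | zero => intro _; exact ih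
      | succ r ihr =>
        intro hr
        rw [Function.iterate_succ_apply', ihr (by omega)]
        ext c
        have e : (n * s + r) / n = s := by
          rw [Nat.mul_add_div (by omega), Nat.div_eq_of_lt (by omega), add_zero]
        have e2 : ww k m (fun v => Al k m zt yt (v / n)) (n * s + (r + 1)) c =
          step k m (Al k m zt yt ((n * s + r) / n))
            (ww k m (fun v => Al k m zt yt (v / n)) (n * s + r)) c := rfl
        rw [e2, e]
    ext c
    rw [show n * (s + 1) = n * s + n by ring, ← this n le_rfl, bb]

lemma lt_card_iff {N : ℕ} (P : Fin N → Prop) [DecidablePred P]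
    (h : ∀ i j, i ≤ j → P j → P i) (j : Fin N) :
    P j ↔ (j : ℕ) < (univ.filter P).card := by
  constructor
  · intro hj
    have : Iic j ⊆ univ.filter P := by
      intro i hi; simp at hi ⊢; exact h i j hi hj
    have := card_le_card this
    rw [Fin.card_Iic] at this; omega
  · intro hj
    by_contra hc
    have : univ.filter P ⊆ Iio j := by
      intro i hi
      simp at hi ⊢
      by_contra h'
      exact hc (h j i (not_lt.1 h') hi)
    have := card_le_card this
    rw [Fin.card_Iio] at this; omega

/-- `gtCond` in unpacked form. -/
structure GC (k m : ℕ) (hm : 0 < m) (zt yt : Fin k → ℤ) (x : Fin k → Fin m → ℤ) : Prop where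
  mono : ∀ i, Monotone (x i)
  low : ∀ i j, zt i ≤ x i j
  high : ∀ i j, x i j ≤ yt i
  diag : ∀ (i : Fin k) (hi : (i : ℕ) + 1 < k) (j : ℕ) (hj : j + 1 < m),
    x i ⟨j + 1, hj⟩ ≤ x ⟨i + 1, hi⟩ ⟨j, by omega⟩
  dz : ∀ (i : Fin k) (hi : (i : ℕ) + 1 < k), x i ⟨0, hm⟩ ≤ zt ⟨i + 1, hi⟩
  dy : ∀ (i : Fin k) (hi : (i : ℕ) + 1 < k), yt i ≤ x ⟨i + 1, hi⟩ ⟨m - 1, by omega⟩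

/-- From points to sequences. -/
noncomputable def toF (T : ℕ) (x : Fin k → Fin m → ℤ) (v : Fin T) (i : Fin k) : ℤ :=
  ((univ.filter fun j : Fin m => x i j ≤ (v : ℕ)).card : ℤ)

/-- From sequences to points. -/
noncomputable def toX (T : ℕ) (f : Fin T → Fin k → ℤ) (i : Fin k) (j : Fin m) : ℤ :=
  ((univ.filter fun v : Fin T => f v i ≤ (j : ℕ)).card : ℤ)

lemma toF_iff {T : ℕ} {x : Fin k → Fin m → ℤ} (hx : ∀ i, Monotone (x i)) (v : Fin T) (i : Fin k)
    (j : Fin m) : x i j ≤ (v : ℕ) ↔ ((j : ℕ) : ℤ) < toF T x v i := by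
  rw [toF, Nat.cast_lt]
  exact lt_card_iff (fun j : Fin m => x i j ≤ (v : ℕ)) (fun a b h h' => (hx i h).trans h') j

lemma toX_iff {T : ℕ} {f : Fin T → Fin k → ℤ} (hf : Monotone f) (v : Fin T) (i : Fin k)
    (j : Fin m) : f v i ≤ (j : ℕ) ↔ ((v : ℕ) : ℤ) < toX T f i j := by
  rw [toX, Nat.cast_lt]
  exact lt_card_iff (fun v : Fin T => f v i ≤ (j : ℕ)) (fun a b h h' => (hf h i).trans h') v

lemma card_lt {N : ℕ} {a : ℤ} (h0 : 0 ≤ a) (h1 : a ≤ N) :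
    ((univ.filter fun v : Fin N => ((v : ℕ) : ℤ) < a).card : ℤ) = a := by
  obtain ⟨b, rfl⟩ : ∃ b : ℕ, a = b := ⟨a.toNat, by omega⟩
  have hb : b ≤ N := by omega
  simp only [Nat.cast_lt]
  rw [Fin.card_filter_val_lt]
  simp [hb]

lemma toF_nonneg {T : ℕ} (x : Fin k → Fin m → ℤ) (v : Fin T) (i : Fin k) : 0 ≤ toF T x v i := by
  rw [toF]; positivity

lemma toF_le {T : ℕ} (x : Fin k → Fin m → ℤ) (v : Fin T) (i : Fin k) : toF T x v i ≤ m := by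
  rw [toF, Nat.cast_le]; exact (card_le_univ _).trans (by simp)

lemma toX_nonneg {T : ℕ} (f : Fin T → Fin k → ℤ) (i : Fin k) (j : Fin m) : 0 ≤ toX T f i j := by
  rw [toX]; positivity

lemma toX_le {T : ℕ} (f : Fin T → Fin k → ℤ) (i : Fin k) (j : Fin m) : toX T f i j ≤ T := by
  rw [toX, Nat.cast_le]; exact (card_le_univ _).trans (by simp)

lemma le_of_forall_fin {T : ℕ} {p q : ℤ} (hp : p ≤ T) (hq : 0 ≤ q)
    (h : ∀ v : Fin T, ((v : ℕ) : ℤ) < p → ((v : ℕ) : ℤ) < q) : p ≤ q := by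
  by_contra hc
  push Not at hc
  have := h ⟨q.toNat, by omega⟩ (by simp; omega)
  simp at this
  try omega

variable {zt yt : Fin k → ℕ} {n S : ℕ}

lemma div_facts (hn : 1 ≤ n) (v a : ℕ) :
    (a ≤ v / n ↔ (n : ℤ) * a ≤ v) ∧ (v / n < a ↔ (v : ℤ) < (n : ℤ) * a) := by
  have h1 : a ≤ v / n ↔ (n : ℤ) * a ≤ v := by
    rw [Nat.le_div_iff_mul_le (by omega), mul_comm]; norm_cast
  exact ⟨h1, by rw [← not_le, h1, not_le]⟩

lemma toF_Al (hm : 0 < m) (hn : 1 ≤ n) {T : ℕ} {x : Fin k → Fin m → ℤ}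
    (hx : GC k m hm (fun i => (n : ℤ) * zt i) (fun i => (n : ℤ) * yt i) x) (v : Fin T) :
    Al k m zt yt ((v : ℕ) / n) (toF T x v) := by
  have hd := div_facts hn (v : ℕ)
  have iff := toF_iff hx.mono v
  have hb : ∀ i, yt i ≤ (v : ℕ) / n → toF T x v i = m := by
    intro i h
    have h1 := (iff i ⟨m - 1, by omega⟩).1 ((hx.high _ _).trans ((hd _).1.1 h))
    have := toF_le x v i
    simp only at h1; omega
  have he : ∀ (i : Fin k) (hi : (i : ℕ) + 1 < k), toF T x v ⟨i + 1, hi⟩ = m →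
      yt i ≤ (v : ℕ) / n := by
    intro i hi h
    rw [(hd _).1]
    refine (hx.dy i hi).trans ((iff _ _).2 ?_)
    rw [h]; simp only; omega
  refine ⟨⟨toF_nonneg x v, toF_le x v, ?_, ?_, he⟩, hb, ?_⟩
  · intro i h
    by_contra hc
    have h0 := toF_nonneg x v i
    have h1 := (iff i ⟨0, hm⟩).2 (by simp only; omega)
    have h2 : (n : ℤ) * zt i ≤ _ := hx.low i ⟨0, hm⟩
    have h3 := (hd _).2.1 h
    omega
  · intro i hi
    by_cases h1 : toF T x v ⟨i + 1, hi⟩ = m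
    · exact Or.inr (Or.inr (hb i (he i hi h1)))
    · by_cases h2 : toF T x v ⟨i + 1, hi⟩ ≤ 0
      · exact Or.inl h2
      · right; left
        have h3 := toF_le x v ⟨i + 1, hi⟩
        obtain ⟨a, ha⟩ : ∃ a : ℕ, toF T x v ⟨i + 1, hi⟩ = a + 1 :=
          ⟨(toF T x v ⟨i + 1, hi⟩ - 1).toNat, by omega⟩
        have h4 := (iff ⟨i + 1, hi⟩ ⟨a, by omega⟩).2 (by rw [ha]; simp)
        have h5 := (iff i ⟨a + 1, by omega⟩).1 ((hx.diag i hi a (by omega)).trans h4)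
        rw [ha]; simpa using h5
  · intro i hi h
    have h1 := (hd _).1.1 h
    have := (iff i ⟨0, hm⟩).1 ((hx.dz i hi).trans h1)
    simpa using this

lemma toX_GC (hm : 0 < m) (hn : 1 ≤ n) (hS : ∀ i, yt i ≤ S)
    {f : Fin (n * (S + 1)) → Fin k → ℤ} (hf : Monotone f)
    (hA : ∀ v : Fin (n * (S + 1)), Al k m zt yt ((v : ℕ) / n) (f v)) :
    GC k m hm (fun i => (n : ℤ) * zt i) (fun i => (n : ℤ) * yt i) (toX (n * (S + 1)) f) := by
  have iff := fun v i (j : Fin m) => toX_iff hf v i j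
  have hzS : ∀ i, zt i ≤ S := by
    intro i
    by_contra hc
    have hlt : n * S < n * (S + 1) := by nlinarith
    have h1 := hA ⟨n * S, hlt⟩
    have e : n * S / n = S := Nat.mul_div_cancel_left _ (by omega)
    simp only [e] at h1
    have := h1.a i (by omega)
    have := h1.b i (hS i)
    omega
  have hb : ∀ a : ℕ, a ≤ S → (n : ℤ) * a ≤ ((n * (S + 1) : ℕ) : ℤ) := by
    intro a ha
    have : n * a ≤ n * (S + 1) := Nat.mul_le_mul_left n (by omega)
    exact_mod_cast this
  refine ⟨?_, ?_, ?_, ?_, ?_, ?_⟩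
  · intro i j j' hj
    apply le_of_forall_fin (toX_le f i j) (toX_nonneg f i j')
    intro v hv
    rw [← iff] at hv ⊢
    have : (j : ℕ) ≤ j' := hj
    omega
  · intro i j
    apply le_of_forall_fin (hb _ (hzS i)) (toX_nonneg f i j)
    intro v hv
    rw [← iff, (hA v).a i ((div_facts hn _ _).2.2 hv)]
    omega
  · intro i j
    apply le_of_forall_fin (toX_le f i j) (by positivity)
    intro v hv
    rw [← iff] at hv
    rw [← (div_facts hn _ _).2]
    by_contra hc
    have := (hA v).b i (not_lt.1 hc)
    omega
  · intro i hi j hj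
    apply le_of_forall_fin (toX_le f i _) (toX_nonneg f _ _)
    intro v hv
    rw [← iff] at hv ⊢
    have := (hA v).cc i hi
    simp only at *
    omega
  · intro i hi
    apply le_of_forall_fin (toX_le f i _) (by positivity)
    intro v hv
    rw [← iff] at hv
    rw [← (div_facts hn _ _).2]
    by_contra hc
    have := (hA v).d i hi (not_lt.1 hc)
    simp only at *
    omega
  · intro i hi
    apply le_of_forall_fin (hb _ (hS i)) (toX_nonneg f _ _)
    intro v hv
    rw [← iff]
    have h1 := (div_facts hn _ _).2.2 hv
    have h2 := (hA v).e i hi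
    have h3 := (hA v).le ⟨i + 1, hi⟩
    simp only at *
    omega

lemma card_GC (hm : 0 < m) (hn : 1 ≤ n) (hS : ∀ i, yt i ≤ S) :
    Nat.card {x : Fin k → Fin m → ℤ //
      GC k m hm (fun i => (n : ℤ) * zt i) (fun i => (n : ℤ) * yt i) x} =
    (Sq k m (fun v => Al k m zt yt (v / n)) (n * (S + 1)) (fun _ => (m : ℤ))).card := by
  have h2 : ∀ x : Fin k → Fin m → ℤ,
      GC k m hm (fun i => (n : ℤ) * zt i) (fun i => (n : ℤ) * yt i) x →
      toX (n * (S + 1)) (toF (n * (S + 1)) x) = x := by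
    intro x hx
    ext i j
    rw [toX]
    have e : ∀ v : Fin (n * (S + 1)), toF (n * (S + 1)) x v i ≤ (j : ℕ) ↔ ((v : ℕ) : ℤ) < x i j := by
      intro v; rw [← not_lt, ← toF_iff hx.mono, not_le]
    simp only [e]
    apply card_lt
    · have h : (n : ℤ) * zt i ≤ _ := hx.low i j
      exact le_trans (by positivity) h
    · have h : _ ≤ (n : ℤ) * yt i := hx.high i j
      refine h.trans ?_
      have : n * yt i ≤ n * (S + 1) := Nat.mul_le_mul_left n ((hS i).trans (by omega))
      exact_mod_cast this
  have h3 : ∀ f ∈ Sq k m (fun v => Al k m zt yt (v / n)) (n * (S + 1)) (fun _ => (m : ℤ)),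
      toF (n * (S + 1)) (toX (m := m) (n * (S + 1)) f) = f := by
    intro f hf
    rw [mem_Sq] at hf
    ext v i
    rw [toF]
    have e : ∀ j : Fin m, toX (n * (S + 1)) f i j ≤ (v : ℕ) ↔ ((j : ℕ) : ℤ) < f v i := by
      intro j; rw [← not_lt, ← toX_iff hf.2.1, not_le]
    simp only [e]
    exact card_lt ((hf.2.2.1 v).nonneg i) ((hf.2.2.1 v).le i)
  rw [← Fintype.card_coe, ← Nat.card_eq_fintype_card]
  apply Nat.card_congr
  refine ⟨fun x => ⟨toF (n * (S + 1)) x.1, ?_⟩, fun f => ⟨toX (n * (S + 1)) f.1, ?_⟩, ?_, ?_⟩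
  · have hA := toF_Al (T := n * (S + 1)) hm hn x.2
    rw [mem_Sq]
    refine ⟨fun v => (hA v).toUp.mem_St, ?_, hA, fun v i => toF_le _ _ _⟩
    intro v v' hv i
    rw [toF, toF, Nat.cast_le]
    apply card_le_card
    intro j hj
    have hv' : (v : ℕ) ≤ v' := hv
    simp only [mem_filter, mem_univ, true_and] at hj ⊢
    omega
  · have hf := mem_Sq.1 f.2
    exact toX_GC hm hn hS hf.2.1 hf.2.2.1
  · intro x; exact Subtype.ext (h2 x.1 x.2)
  · intro f; exact Subtype.ext (h3 f.1 f.2)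

lemma PP_GC (hm : 0 < m) (hz : Monotone zt) (hy : Monotone yt) :
    PP (fun n => (Nat.card {x : Fin k → Fin m → ℤ //
      GC k m hm (fun i => (n : ℤ) * zt i) (fun i => (n : ℤ) * yt i) x} : ℚ)) := by
  classical
  have hS : ∀ i, yt i ≤ ∑ i, yt i := fun i => single_le_sum (fun _ _ => Nat.zero_le _) (mem_univ i)
  refine PP.congr (f := fun n => ∑ c ∈ (St k m).filter (· ≤ fun _ => (m : ℤ)),
    bb k m zt yt n (∑ i, yt i + 1) c) (PP.sum _ fun c _ => PP_bb hm hz hy _ c) ?_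
  intro n hn
  rw [card_GC hm hn hS, ← sum_ww _ _ _ (fun i => by simp), bb_eq_ww n hn]

end

section
variable {k m : ℕ} {zt yt : Fin k → ℤ} {x : Fin k → Fin m → ℤ}

lemma gtExt_zero (i : Fin k) (h : 0 < m + 2) : gtExt k m zt yt x i ⟨0, h⟩ = zt i := by
  simp [gtExt]

lemma gtExt_last (i : Fin k) (h : m + 1 < m + 2) : gtExt k m zt yt x i ⟨m + 1, h⟩ = yt i := by
  simp [gtExt]

lemma gtExt_mid (i : Fin k) (j : ℕ) (hj : j < m) (h : j + 1 < m + 2) :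
    gtExt k m zt yt x i ⟨j + 1, h⟩ = x i ⟨j, hj⟩ := by
  have : j ≠ m := by omega
  simp [gtExt, this]

lemma gtCond_iff (hm : 0 < m) : gtCond k m zt yt x ↔ GC k m hm zt yt x := by
  constructor
  · rintro ⟨h1, h2⟩
    have hmono : ∀ i, Monotone (gtExt k m zt yt x i) := fun i => Fin.monotone_iff_le_succ.2 (h1 i)
    refine ⟨?_, ?_, ?_, ?_, ?_, ?_⟩
    · intro i j j' hj
      rw [← gtExt_mid (zt := zt) (yt := yt) (x := x) i j j.2 (by omega),
        ← gtExt_mid (zt := zt) (yt := yt) (x := x) i j' j'.2 (by omega)]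
      apply hmono
      have h3 : (j : ℕ) ≤ j' := hj
      exact Fin.mk_le_mk.2 (Nat.succ_le_succ h3)
    · intro i j
      rw [← gtExt_mid (zt := zt) (yt := yt) (x := x) i j j.2 (by omega),
        ← gtExt_zero (zt := zt) (yt := yt) (x := x) i (by omega)]
      apply hmono
      exact Fin.mk_le_mk.2 (Nat.zero_le _)
    · intro i j
      rw [← gtExt_mid (zt := zt) (yt := yt) (x := x) i j j.2 (by omega),
        ← gtExt_last (zt := zt) (yt := yt) (x := x) i (by omega)]
      apply hmono
      exact Fin.mk_le_mk.2 (by omega)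
    · intro i hi j hj
      have := h2 i hi ⟨j + 1, by omega⟩
      rw [← gtExt_mid (zt := zt) (yt := yt) (x := x) i (j + 1) hj (by omega),
        ← gtExt_mid (zt := zt) (yt := yt) (x := x) _ j (by omega) (by omega)]
      exact this
    · intro i hi
      have := h2 i hi ⟨0, by omega⟩
      rw [← gtExt_mid (zt := zt) (yt := yt) (x := x) i 0 hm (by omega),
        ← gtExt_zero (zt := zt) (yt := yt) (x := x) _ (by omega)]
      exact this
    · intro i hi
      have := h2 i hi ⟨m - 1 + 1, by omega⟩
      rw [← gtExt_mid (zt := zt) (yt := yt) (x := x) _ (m - 1) (by omega) (by omega),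
        ← gtExt_last (zt := zt) (yt := yt) (x := x) i (by omega)]
      have e : (⟨m + 1, by omega⟩ : Fin (m + 2)) = ⟨m - 1 + 1 + 1, by omega⟩ := by
        ext; simp; omega
      rw [e]
      exact this
  · intro h
    constructor
    · rintro i ⟨j, hj⟩
      change gtExt k m zt yt x i ⟨j, by omega⟩ ≤ gtExt k m zt yt x i ⟨j + 1, by omega⟩
      rcases j with _ | j
      · rw [gtExt_zero, gtExt_mid _ _ hm]; exact h.low _ _
      · rw [gtExt_mid _ _ (by omega)]
        by_cases hjm : j + 1 = m
        · subst hjm; rw [gtExt_last]; exact h.high _ _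
        · rw [gtExt_mid _ _ (by omega)]
          exact h.mono i (by simp [Fin.le_def])
    · rintro i hi ⟨j, hj⟩
      change gtExt k m zt yt x i ⟨j + 1, by omega⟩ ≤ gtExt k m zt yt x ⟨i + 1, hi⟩ ⟨j, by omega⟩
      rcases j with _ | j
      · rw [gtExt_zero, gtExt_mid _ _ hm]; exact h.dz _ _
      · rw [gtExt_mid _ j (by omega)]
        by_cases hjm : j + 1 = m
        · subst hjm; rw [gtExt_last]; exact h.dy _ _
        · rw [gtExt_mid _ (j + 1) (by omega)]
          exact h.diag i hi j (by omega)

end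

end GTP

/-- **Theorem.** The skew Gelfand–Tsetlin polytope `GT_k^m(y, z)` is Ehrhart
positive: there is a polynomial `p ∈ ℚ[n]` with nonnegative coefficients such that
for all `n ≥ 1`, `p(n)` is the number of integer points `(x_{i,j}) ∈ ℤ^{km}` with
`x_{i,j} ≤ x_{i,j+1} ≤ x_{i+1,j}` for all meaningful indices, where
`x_{i,0} := n·z̃_i` and `x_{i,m+1} := n·ỹ_i`. -/
theorem gelfandTsetlin_ehrhart_positivity
    (k m : ℕ) (hk : 0 < k) (hm : 0 < m) (y z : Fin k → ℕ) :
    ∃ p : Polynomial ℚ, (∀ i : ℕ, 0 ≤ p.coeff i) ∧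
      ∀ n : ℕ, 1 ≤ n →
        p.eval (n : ℚ) =
          Nat.card {x : Fin k → Fin m → ℤ //
            gtCond k m
              (fun i => (n : ℤ) * ∑ l ∈ Finset.Iic i, (z l : ℤ))
              (fun i => (n : ℤ) * ∑ l ∈ Finset.Iic i, (y l : ℤ)) x} := by
  have hmono : ∀ u : Fin k → ℕ, Monotone fun i => ∑ l ∈ Finset.Iic i, u l := by
    intro u i j hij
    exact Finset.sum_le_sum_of_subset (Finset.Iic_subset_Iic.2 hij)
  obtain ⟨P, hP, hP'⟩ := GTP.PP_GC hm (hmono z) (hmono y)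
  refine ⟨P, hP, fun n hn => ?_⟩
  rw [hP' n hn]
  simp only [GTP.gtCond_iff hm]
  push_cast
  rfl
end

section
/- Fix k ≥ 1 and m ≥ 1, and let P be the poset on {(i,j) : i ∈ [k], 0 ≤ j ≤ m+1} generated by the cover relations (i,j) < (i,j+1) and (i,j+1) < (i+1,j), with A = {(i,j) ∈ P : j ∈ {0, m+1}} (so that marked order polytopes over (P,A) are exactly the skew Gelfand–Tsetlin polytopes). Then for any natural labeling A = {a_0, a_1, …, a_r}, there exists a polynomial f ∈ ℚ[t_1, …, t_r] all of whose coefficients are nonnegative such that Ω_{P,A}(λ) = f(λ(a_1) − λ(a_0), …, λ(a_r) − λ(a_{r−1})) for every map λ : A → ℤ satisfying λ(a_0) ≤ λ(a_1) ≤ ⋯ ≤ λ(a_r). -/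
/-- The number of order preserving maps `λ̂ : α → ℤ` agreeing with `lam` on the
marked subset `A` (the lattice points of the marked order polytope `O_{P,A}(λ)`). -/
noncomputable def markedCount {α : Type} [PartialOrder α] (A : Set α) (lam : α → ℤ) : ℕ :=
  Nat.card {f : α → ℤ // Monotone f ∧ ∀ a ∈ A, f a = lam a}

/-- The underlying set `{(i, j) : i ∈ [k], 0 ≤ j ≤ m + 1}` of the Gelfand–Tsetlin
poset. -/
def GTPoset (k m : ℕ) : Type := Fin k × Fin (m + 2)

/-- The partial order on `GTPoset k m` generated by the cover relations
`(i, j) < (i, j + 1)` and `(i, j + 1) < (i + 1, j)`; for `m ≥ 1` it is given in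
closed form by `(i, j) ≤ (i', j') ↔ i ≤ i' ∧ i + j ≤ i' + j'`. -/
instance (k m : ℕ) : PartialOrder (GTPoset k m) :=
  PartialOrder.lift (fun p : GTPoset k m => (((p.1 : ℕ)), ((p.1 : ℕ) + (p.2 : ℕ))))
    (by
      intro p q h
      simp only [Prod.mk.injEq] at h
      obtain ⟨h1, h2⟩ := h
      exact Prod.ext (Fin.ext h1) (Fin.ext (by omega)))


namespace GT

open Classical in
/-- Lower subsets of the finset `S`. -/
noncomputable def lowers {α : Type*} [PartialOrder α] (S : Finset α) : Finset (Finset α) :=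
  S.powerset.filter (fun U => ∀ p ∈ U, ∀ q ∈ S, q ≤ p → q ∈ U)

theorem mem_lowers {α : Type*} [PartialOrder α] {S U : Finset α} :
    U ∈ lowers S ↔ U ⊆ S ∧ ∀ p ∈ U, ∀ q ∈ S, q ≤ p → q ∈ U := by
  simp [lowers]

section generic
variable {α : Type*} [PartialOrder α] [DecidableEq α]

/-- number of multichains of lower sets -/
noncomputable def cnt : ℕ → Finset α → ℕ
  | 0, S => if S = ∅ then 1 else 0
  | (t+1), S => ∑ U ∈ lowers S, cnt t U

theorem cnt_zero (S : Finset α) : cnt 0 S = if S = ∅ then 1 else 0 := rfl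
theorem cnt_succ (t : ℕ) (S : Finset α) : cnt (t+1) S = ∑ U ∈ lowers S, cnt t U := rfl

theorem lowers_empty : lowers (∅ : Finset α) = {∅} := by
  ext U; simp only [mem_lowers, Finset.subset_empty, Finset.mem_singleton]
  exact ⟨fun h => h.1, fun h => ⟨h, by simp⟩⟩

theorem cnt_empty (t : ℕ) : cnt t (∅ : Finset α) = 1 := by
  induction t with
  | zero => simp [cnt]
  | succ t ih => simp [cnt, lowers_empty, ih]

theorem cnt_conv (s t : ℕ) (S : Finset α) :
    cnt (s + t) S = ∑ U ∈ lowers S, cnt s U * cnt t (S \ U) := by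
  induction t generalizing S with
  | zero =>
    rw [Finset.sum_eq_single_of_mem S (mem_lowers.2 ⟨subset_rfl, fun _ _ _ h _ => h⟩)]
    · simp [cnt]
    · intro U hU hne
      have : S \ U ≠ ∅ := by
        intro h
        exact hne (subset_antisymm (mem_lowers.1 hU).1 (Finset.sdiff_eq_empty_iff_subset.1 h))
      simp [cnt, this]
  | succ t ih =>
    rw [← add_assoc, cnt_succ]
    simp only [ih, cnt_succ, Finset.mul_sum]
    rw [Finset.sum_sigma', Finset.sum_sigma']
    refine Finset.sum_bij' (fun x _ => ⟨x.2, x.1 \ x.2⟩) (fun x _ => ⟨x.1 ∪ x.2, x.1⟩) ?_ ?_ ?_ ?_ ?_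
    · rintro ⟨V, U⟩ h
      simp only [Finset.mem_sigma, mem_lowers] at h ⊢
      obtain ⟨⟨h1, h2⟩, h3, h4⟩ := h
      refine ⟨⟨h3.trans h1, fun p hp q hq hqp => h4 p hp q (h2 p (h3 hp) q hq hqp) hqp⟩, ?_, ?_⟩
      · exact Finset.sdiff_subset_sdiff h1 subset_rfl
      · intro p hp q hq hqp
        simp only [Finset.mem_sdiff] at *
        exact ⟨h2 p hp.1 q hq.1 hqp, hq.2⟩
    · rintro ⟨U, V⟩ h
      simp only [Finset.mem_sigma, mem_lowers] at h ⊢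
      obtain ⟨⟨h1, h2⟩, h3, h4⟩ := h
      refine ⟨⟨Finset.union_subset h1 (h3.trans Finset.sdiff_subset), ?_⟩, Finset.subset_union_left, ?_⟩
      · intro p hp q hq hqp
        by_cases hqU : q ∈ U
        · exact Finset.mem_union_left _ hqU
        rcases Finset.mem_union.1 hp with hp | hp
        · exact Finset.mem_union_left _ (h2 p hp q hq hqp)
        · exact Finset.mem_union_right _ (h4 p hp q (Finset.mem_sdiff.2 ⟨hq, hqU⟩) hqp)
      · intro p hp q hq hqp
        refine h2 p hp q ?_ hqp
        rcases Finset.mem_union.1 hq with hq | hq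
        · exact h1 hq
        · exact (Finset.mem_sdiff.1 (h3 hq)).1
    · rintro ⟨V, U⟩ h
      simp only [Finset.mem_sigma, mem_lowers] at h
      simp [Finset.union_eq_right.2 h.2.1]
    · rintro ⟨U, V⟩ h
      simp only [Finset.mem_sigma, mem_lowers] at h
      have : Disjoint U V := by
        rw [Finset.disjoint_left]; intro x hx hv
        exact (Finset.mem_sdiff.1 (h.2.1 hv)).2 hx
      simp [Finset.union_sdiff_cancel_left this]
    · rintro ⟨V, U⟩ h
      rfl

theorem cnt_map {β : Type*} [PartialOrder β] [DecidableEq β] (φ : α ↪o β) (t : ℕ) (S : Finset α) :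
    cnt t (S.map φ.toEmbedding) = cnt t S := by
  induction t generalizing S with
  | zero => simp [cnt]
  | succ t ih =>
    rw [cnt_succ, cnt_succ]
    symm
    refine Finset.sum_bij (fun U _ => U.map φ.toEmbedding) ?_ ?_ ?_ ?_
    · intro U hU
      rw [mem_lowers] at hU ⊢
      refine ⟨Finset.map_subset_map.2 hU.1, ?_⟩
      intro p hp q hq hqp
      obtain ⟨p, hp', rfl⟩ := Finset.mem_map.1 hp
      obtain ⟨q, hq', rfl⟩ := Finset.mem_map.1 hq
      exact Finset.mem_map_of_mem _ (hU.2 p hp' q hq' (φ.le_iff_le.1 hqp))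
    · intro U _ V _ h
      exact Finset.map_injective _ h
    · intro V hV
      rw [mem_lowers] at hV
      obtain ⟨U, hU, rfl⟩ := Finset.subset_map_iff.1 hV.1
      refine ⟨U, ?_, rfl⟩
      rw [mem_lowers]
      refine ⟨hU, fun p hp q hq hqp => ?_⟩
      have := hV.2 (φ p) (Finset.mem_map_of_mem _ hp) (φ q) (Finset.mem_map_of_mem _ hq)
        (φ.le_iff_le.2 hqp)
      simpa using this
    · intro U _; exact (ih U).symm

/-- finite convex sets -/
def Cvx (S : Finset α) : Prop := ∀ p ∈ S, ∀ q ∈ S, ∀ x, p ≤ x → x ≤ q → x ∈ S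

theorem Cvx.lower {S U : Finset α} (h : Cvx S) (hU : U ∈ lowers S) : Cvx U := by
  rw [mem_lowers] at hU
  intro p hp q hq x h1 h2
  exact hU.2 q hq x (h p (hU.1 hp) q (hU.1 hq) x h1 h2) h2

theorem Cvx.sdiff {S U : Finset α} (h : Cvx S) (hU : U ∈ lowers S) : Cvx (S \ U) := by
  rw [mem_lowers] at hU
  intro p hp q hq x h1 h2
  rw [Finset.mem_sdiff] at *
  exact ⟨h p hp.1 q hq.1 x h1 h2, fun hx => hp.2 (hU.2 x hx p hp.1 h1)⟩

open Polynomial in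
/-- From nonnegative linear coefficients to nonnegative coefficients. -/
theorem nonneg_of_linear
    (H : ∀ S : Finset α, Cvx S → ∃ p : ℚ[X], (∀ t : ℕ, (cnt t S : ℚ) = p.eval (t : ℚ)) ∧
      0 ≤ (derivative p).eval 0) (S : Finset α) (hS : Cvx S) :
    ∃ p : ℚ[X], (∀ t : ℕ, (cnt t S : ℚ) = p.eval (t : ℚ)) ∧ ∀ n, 0 ≤ p.coeff n := by
  have natinf : ∀ p q : ℚ[X], (∀ t : ℕ, p.eval (t : ℚ) = q.eval (t : ℚ)) → p = q := by
    intro p q h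
    apply Polynomial.eq_of_infinite_eval_eq
    refine (Set.infinite_range_of_injective (Nat.cast_injective (R := ℚ))).mono ?_
    rintro _ ⟨t, rfl⟩
    exact h t
  choose! p hp hl using H
  refine ⟨p S, hp S hS, ?_⟩
  have key1 : ∀ S : Finset α, Cvx S → ∀ t : ℕ,
      (derivative (p S)).eval (t : ℚ) =
        ∑ U ∈ lowers S, (p (S \ U)).eval (t : ℚ) * (derivative (p U)).eval 0 := by
    intro S hS t
    have : (p S).comp (X + C (t : ℚ)) = ∑ U ∈ lowers S, C ((p (S \ U)).eval (t : ℚ)) * p U := by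
      apply natinf
      intro s
      rw [eval_comp]
      have := hp S hS (s + t)
      rw [cnt_conv] at this
      simp only [eval_add, eval_X, eval_C, eval_finsetSum, eval_mul]
      push_cast at this
      rw [← this]
      refine Finset.sum_congr rfl fun U hU => ?_
      rw [← hp U (hS.lower hU), ← hp _ (hS.sdiff hU), mul_comm]
    have := congrArg (fun q => (derivative q).eval 0) this
    simpa [derivative_comp, eval_finsetSum] using this
  have key : ∀ S : Finset α, Cvx S →
      derivative (p S) = ∑ U ∈ lowers S, C ((derivative (p U)).eval 0) * p (S \ U) := by
    intro S hS
    apply natinf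
    intro t
    rw [key1 S hS]
    simp [eval_finsetSum, mul_comm]
  clear key1
  have main : ∀ N : ℕ, ∀ S : Finset α, S.card = N → Cvx S → ∀ n, 0 ≤ (p S).coeff n := by
    intro N
    induction N using Nat.strong_induction_on with
    | _ N ih =>
    intro S hN hS n
    rcases n with _ | n
    · rw [coeff_zero_eq_eval_zero]
      have := hp S hS 0
      simp only [Nat.cast_zero] at this
      rw [← this]; positivity
    · have h1 : 0 ≤ (derivative (p S)).coeff n := by
        rw [key S hS, finsetSum_coeff]
        refine Finset.sum_nonneg fun U hU => ?_
        rw [coeff_C_mul]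
        by_cases hU0 : U = ∅
        · subst hU0
          have : p (∅ : Finset α) = 1 := by
            apply natinf
            intro t
            rw [← hp ∅ (hS.lower hU)]
            simp [cnt_empty]
          simp [this]
        · refine mul_nonneg (hl U (hS.lower hU)) (ih (S \ U).card ?_ _ rfl (hS.sdiff hU) n)
          rw [← hN]
          refine Finset.card_lt_card (Finset.sdiff_ssubset (mem_lowers.1 hU).1 ?_)
          exact Finset.nonempty_iff_ne_empty.2 hU0
      rw [coeff_derivative] at h1
      have h2 : (0 : ℚ) < (n : ℚ) + 1 := by positivity
      exact nonneg_of_mul_nonneg_left h1 h2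
  exact main _ S rfl hS

end generic
end GT

namespace GT

open Finset in
/-- The complete homogeneous symmetric polynomial `h_n(1^x)`. -/
noncomputable def hq {R : Type*} [CommRing R] [Algebra ℚ R] (x : R) (n : ℤ) : R :=
  if n < 0 then 0 else (1 / (n.toNat.factorial : ℚ)) • ∏ l ∈ range n.toNat, (x + (l : R))

section hq
variable {R : Type*} [CommRing R] [Algebra ℚ R]

theorem hq_neg (x : R) {n : ℤ} (h : n < 0) : hq x n = 0 := by simp [hq, h]

theorem hq_zero (x : R) : hq x 0 = 1 := by simp [hq]

theorem hq_nat (x : R) (n : ℕ) :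
    hq x n = (1 / (n.factorial : ℚ)) • ∏ l ∈ Finset.range n, (x + (l : R)) := by
  simp [hq]

theorem hq_pascal (x : R) (n : ℤ) : hq (x + 1) n = hq x n + hq (x + 1) (n - 1) := by
  rcases lt_trichotomy n 0 with h | h | h
  · rw [hq_neg _ h, hq_neg _ h, hq_neg _ (by omega)]; simp
  · subst h
    rw [hq_zero, hq_zero, hq_neg _ (by omega)]; simp
  · obtain ⟨m, rfl⟩ : ∃ m : ℕ, n = ((m + 1 : ℕ) : ℤ) := ⟨n.toNat - 1, by omega⟩
    rw [show ((m + 1 : ℕ) : ℤ) - 1 = (m : ℤ) by push_cast; ring, hq_nat, hq_nat, hq_nat]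
    have e : ∏ l ∈ Finset.range (m+1), (x + (l : R)) =
        x * ∏ l ∈ Finset.range m, (x + 1 + (l : R)) := by
      rw [Finset.prod_range_succ', mul_comm]
      congr 1
      · simp
      · refine Finset.prod_congr rfl fun l _ => ?_
        push_cast; ring
    rw [e, Finset.prod_range_succ]
    generalize ∏ l ∈ Finset.range m, (x + 1 + (l : R)) = Q
    have h3 : (1 / (m.factorial : ℚ)) = (1 / ((m+1).factorial : ℚ)) * (m + 1) := by
      rw [Nat.factorial_succ]; push_cast
      have : (m.factorial : ℚ) ≠ 0 := by positivity
      have : (m : ℚ) + 1 ≠ 0 := by positivity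
      field_simp
    rw [h3, mul_smul, ← smul_add]
    congr 1
    rw [Algebra.smul_def]
    simp only [map_add, map_natCast, map_one]
    ring

theorem hq_map {R' : Type*} [CommRing R'] [Algebra ℚ R'] (φ : R →+* R') (x : R) (n : ℤ) :
    φ (hq x n) = hq (φ x) n := by
  unfold hq
  split_ifs
  · simp
  · have : ∀ (c : ℚ) (y : R), φ (c • y) = c • φ y := fun c y => map_rat_smul φ c y
    rw [this]; simp

theorem hq_negnat (d : ℕ) (n : ℤ) (h : (d : ℤ) < n) : hq (-(d : R)) n = 0 := by
  obtain ⟨m, rfl⟩ : ∃ m : ℕ, n = (m : ℤ) := ⟨n.toNat, by omega⟩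
  rw [hq_nat, Finset.prod_eq_zero (i := d) (by simp; omega) (by ring), smul_zero]

theorem hq_one (n : ℤ) (h : 0 ≤ n) : hq (1 : ℚ) n = 1 := by
  obtain ⟨m, rfl⟩ : ∃ m : ℕ, n = (m : ℤ) := ⟨n.toNat, by omega⟩
  rw [hq_nat, ← Finset.prod_range_add_one_eq_factorial]
  have : (∏ l ∈ Finset.range m, (1 + (l : ℚ))) = ((∏ x ∈ Finset.range m, (x + 1) : ℕ) : ℚ) := by
    push_cast
    exact Finset.prod_congr rfl fun _ _ => by ring
  rw [this, smul_eq_mul]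
  have h0 : ((∏ x ∈ Finset.range m, (x + 1) : ℕ) : ℚ) ≠ 0 := by
    rw [Finset.prod_range_add_one_eq_factorial]; positivity
  field_simp

end hq

/-- The Kreweras matrix. -/
noncomputable def KM {R : Type*} [CommRing R] [Algebra ℚ R] {k : ℕ} (x : R) (p : ℕ)
    (μ ν : Fin k → ℤ) : Matrix (Fin k) (Fin k) R :=
  fun i j => hq (x + (((i : ℤ) - (j : ℤ) : ℤ) : R) + if (i : ℕ) < p then 1 else 0)
    (ν i - μ j - (i : ℤ) + (j : ℤ))

theorem KM_map {R : Type*} [CommRing R] [Algebra ℚ R] {R' : Type*} [CommRing R'] [Algebra ℚ R']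
    {k : ℕ} (φ : R →+* R') (x : R) (p : ℕ) (μ ν : Fin k → ℤ) :
    φ ((KM x p μ ν).det) = (KM (φ x) p μ ν).det := by
  rw [RingHom.map_det]
  congr 1
  ext i j
  simp only [RingHom.mapMatrix_apply, Matrix.map_apply, KM, hq_map]
  congr 1
  split_ifs <;> simp

theorem KM_full {k : ℕ} (x : ℚ) (μ ν : Fin k → ℤ) : KM x k μ ν = KM (x + 1) 0 μ ν := by
  ext i j
  simp only [KM, i.2, if_true, Nat.not_lt_zero, if_false]
  congr 1; ring

theorem KM_step {k : ℕ} (x : ℚ) (p : Fin k) (μ ν : Fin k → ℤ) :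
    (KM x (p + 1) μ ν).det = (KM x p μ ν).det +
      (KM x (p + 1) μ (Function.update ν p (ν p - 1))).det := by
  have h1 : KM x p μ ν = (KM x (p + 1) μ ν).updateRow p (KM x p μ ν p) := by
    ext i j
    rw [Matrix.updateRow_apply]
    split_ifs with h
    · subst h; rfl
    · have : (i : ℕ) < p ↔ (i : ℕ) < p + 1 := by
        have : (i : ℕ) ≠ p := fun h' => h (Fin.ext h')
        omega
      simp only [KM, this]
  have h2 : KM x (p + 1) μ (Function.update ν p (ν p - 1)) = (KM x (p + 1) μ ν).updateRow p
      (KM x (p + 1) μ (Function.update ν p (ν p - 1)) p) := by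
    ext i j
    rw [Matrix.updateRow_apply]
    split_ifs with h
    · subst h; rfl
    · simp only [KM, Function.update_of_ne h]
  rw [h1, h2, ← Matrix.det_updateRow_add]
  congr 1
  ext i j
  rw [Matrix.updateRow_apply]
  split_ifs with h
  · subst h
    simp only [KM, Pi.add_apply, Function.update_self]
    simp only [lt_irrefl, if_false, Nat.lt_succ_self, if_true, add_zero]
    rw [hq_pascal]
    congr 2; ring
  · rfl

theorem det_zero_block {k : ℕ} (M : Matrix (Fin k) (Fin k) ℚ) (p : Fin k)
    (h : ∀ i j, p ≤ i → j ≤ p → M i j = 0) : M.det = 0 := by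
  rw [Matrix.det_apply]
  refine Finset.sum_eq_zero fun σ _ => ?_
  suffices H : ∃ j, j ≤ p ∧ p ≤ σ j by
    obtain ⟨j, h1, h2⟩ := H
    rw [Finset.prod_eq_zero (f := fun i => M (σ i) i) (Finset.mem_univ j) (h _ _ h2 h1), smul_zero]
  by_contra! hc
  have := Finset.card_le_card_of_injOn (s := Finset.Iic p) (t := Finset.Iio p) σ
    (fun j hj => by simpa using hc j (by simpa using hj)) (σ.injective.injOn)
  simp at this

/-- skew shape cells -/
noncomputable def cells {k : ℕ} (μ ν : Fin k → ℤ) : Finset (Fin k × ℤ) :=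
  Finset.univ.biUnion fun i => {i} ×ˢ Finset.Ico (μ i) (ν i)

theorem mem_cells {k : ℕ} {μ ν : Fin k → ℤ} {x : Fin k × ℤ} :
    x ∈ cells μ ν ↔ μ x.1 ≤ x.2 ∧ x.2 < ν x.1 := by
  simp only [cells, Finset.mem_biUnion, Finset.mem_univ, true_and, Finset.mem_product,
    Finset.mem_singleton, Finset.mem_Ico]
  constructor
  · rintro ⟨i, h, h2⟩; rw [h]; exact h2
  · intro h; exact ⟨x.1, rfl, h⟩

open Classical in
/-- lower sets containing all rows from `p` on -/
noncomputable def GG {k : ℕ} (μ ν : Fin k → ℤ) (p : ℕ) : Finset (Finset (Fin k × ℤ)) :=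
  (lowers (cells μ ν)).filter fun U => ∀ x ∈ cells μ ν, p ≤ (x.1 : ℕ) → x ∈ U

theorem mem_GG {k : ℕ} {μ ν : Fin k → ℤ} {p : ℕ} {U : Finset (Fin k × ℤ)} :
    U ∈ GG μ ν p ↔ U ∈ lowers (cells μ ν) ∧ ∀ x ∈ cells μ ν, p ≤ (x.1 : ℕ) → x ∈ U := by
  simp [GG]

theorem GG_step {k : ℕ} (μ : Fin k → ℤ) (hμ : Antitone μ) (t : ℕ)
    (E : ∀ ν : Fin k → ℤ, Antitone ν → μ ≤ ν → (cnt t (cells μ ν) : ℚ) = (KM (t : ℚ) 0 μ ν).det)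
    (p : ℕ) (hp : p ≤ k) :
    ∀ ν : Fin k → ℤ, Antitone ν → μ ≤ ν →
      ∑ U ∈ GG μ ν p, (cnt t U : ℚ) = (KM (t : ℚ) p μ ν).det := by
  induction p with
  | zero =>
    intro ν hν hμν
    have : GG μ ν 0 = {cells μ ν} := by
      ext U
      simp only [mem_GG, mem_lowers, Finset.mem_singleton, Nat.zero_le, true_implies]
      constructor
      · rintro ⟨⟨h1, _⟩, h2⟩; exact subset_antisymm h1 h2
      · rintro rfl; exact ⟨⟨subset_rfl, fun _ _ _ h _ => h⟩, fun _ h => h⟩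
    rw [this, Finset.sum_singleton, E ν hν hμν]
  | succ p ih =>
    replace ih := ih (by omega)
    set P : Fin k := ⟨p, hp⟩ with hP
    suffices H : ∀ N : ℕ, ∀ ν : Fin k → ℤ, Antitone ν → μ ≤ ν → (ν P - μ P).toNat = N →
      ∑ U ∈ GG μ ν (p + 1), (cnt t U : ℚ) = (KM (t : ℚ) (p + 1) μ ν).det from
      fun ν h1 h2 => H _ ν h1 h2 rfl
    intro N
    induction N with
    | zero =>
      intro ν hν hμν hN
      have h0 : ν P = μ P := by have : μ P ≤ ν P := hμν P; omega
      have e1 : GG μ ν (p + 1) = GG μ ν p := by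
        ext U
        simp only [mem_GG, and_congr_right_iff]
        intro hU
        constructor
        · intro h x hx hpx
          refine h x hx ?_
          rcases hpx.lt_or_eq with h3 | h3
          · exact h3
          · have : x.1 = P := Fin.ext h3.symm
            rw [mem_cells, this] at hx; omega
        · intro h x hx hpx; exact h x hx (by omega)
      rw [e1, ih ν hν hμν, KM_step (t : ℚ) P μ ν, det_zero_block (KM (t : ℚ) (↑P + 1) μ _) P, add_zero]
      intro i j hi hj
      refine hq_neg _ ?_
      have h4 := hμ hj
      have h5 := hν hi
      have h6 : (P : ℕ) ≤ i := hi
      have h7 : (j : ℕ) ≤ P := hj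
      by_cases h : i = P
      · subst h; rw [Function.update_self]; omega
      · have : (i : ℕ) ≠ P := fun h' => h (Fin.ext h')
        rw [Function.update_of_ne h]; omega
    | succ N ihN =>
      intro ν hν hμν hN
      have hlt : μ P < ν P := by omega
      by_cases hc : ∃ Q : Fin k, (Q : ℕ) = p + 1 ∧ ν Q = ν P
      · obtain ⟨Q, hQ, hνQ⟩ := hc
        have hPQ : P ≤ Q := by rw [Fin.le_def, hQ]; simp [hP]
        have e1 : GG μ ν (p + 1) = GG μ ν p := by
          ext U
          simp only [mem_GG, and_congr_right_iff]
          intro hU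
          constructor
          · intro h x hx hpx
            rcases hpx.lt_or_eq with h3 | h3
            · exact h x hx h3
            · have hxP : x.1 = P := Fin.ext h3.symm
              have hy : ((Q, ν P - 1) : Fin k × ℤ) ∈ cells μ ν := by
                rw [mem_cells]
                have := hμ hPQ
                simp only
                omega
              refine (mem_lowers.1 hU).2 _ (h _ hy (by simp [hQ])) x hx ?_
              rw [mem_cells, hxP] at hx
              rw [Prod.le_def]
              refine ⟨hxP ▸ hPQ, ?_⟩
              simp only
              omega
          · intro h x hx hpx; exact h x hx (by omega)
        rw [e1, ih ν hν hμν, KM_step (t : ℚ) P μ ν]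
        rw [Matrix.det_zero_of_row_eq (i := P) (j := Q) (M := KM (t : ℚ) (↑P + 1) μ _), add_zero]
        · intro h; rw [← h] at hQ; simp [hP] at hQ
        · ext j
          have hne : Q ≠ P := fun h => by rw [h] at hQ; simp [hP] at hQ
          simp only [KM, Function.update_self, Function.update_of_ne hne, hνQ, hQ]
          simp only [hP, Nat.lt_succ_self, if_true, lt_irrefl, if_false]
          congr 1
          · push_cast; ring
          · push_cast; ring
      · push Not at hc
        set ν' := Function.update ν P (ν P - 1) with hν'
        have hPv : ν' P = ν P - 1 := by simp [hν']
        have hnv : ∀ i, i ≠ P → ν' i = ν i := fun i hi => by simp [hν', Function.update_of_ne hi]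
        have hle : ∀ i, ν' i ≤ ν i := fun i => by
          by_cases h : i = P
          · subst h; omega
          · rw [hnv i h]
        have hanti : Antitone ν' := by
          intro i j hij
          by_cases hi : i = P
          · by_cases hj : j = P
            · rw [hi, hj]
            · rw [hi, hPv, hnv j hj]
              have hlt' : (P : ℕ) < j := by
                have h1 : (P : ℕ) ≤ j := hi ▸ hij
                have h2 : (j : ℕ) ≠ P := fun h' => hj (Fin.ext h')
                omega
              have hk : p + 1 < k := by have := j.2; simp only [hP] at hlt'; omega
              have h3 := hc ⟨p + 1, hk⟩ rfl
              have h4 : ν ⟨p + 1, hk⟩ ≤ ν P := hν (by rw [Fin.le_def]; simp [hP])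
              have h5 : ν j ≤ ν ⟨p + 1, hk⟩ := hν (by rw [Fin.le_def]; simp [hP] at hlt' ⊢; omega)
              omega
          · rw [hnv i hi]
            exact (hle j).trans (hν hij)
        have hμν' : μ ≤ ν' := by
          intro i
          by_cases h : i = P
          · subst h; rw [hPv]; simp only; omega
          · rw [hnv i h]; exact hμν i
        set x0 : Fin k × ℤ := (P, ν P - 1) with hx0
        have hcell : ∀ x, x ∈ cells μ ν ↔ x = x0 ∨ x ∈ cells μ ν' := by
          intro x
          rw [mem_cells, mem_cells]
          obtain ⟨i, c⟩ := x
          simp only [hx0, Prod.mk.injEq]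
          by_cases h : i = P
          · subst h; simp only [true_and, hPv]; omega
          · rw [hnv i h]; simp [h]
        have hx0n : x0 ∉ cells μ ν' := by rw [mem_cells]; simp [hx0, hPv]
        have hmax : ∀ x ∈ cells μ ν, x0 ≤ x → x = x0 := by
          rintro ⟨i, c⟩ hx hle
          rw [mem_cells] at hx
          rw [Prod.le_def] at hle
          simp only [hx0] at hx hle
          by_cases h : i = P
          · subst h; rw [hx0]; ext <;> simp; omega
          · exfalso
            have := hanti hle.1
            rw [hnv i h, hPv] at this
            omega
        have e1 : GG μ ν (p + 1) = GG μ ν p ∪ GG μ ν' (p + 1) := by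
          ext U
          simp only [Finset.mem_union, mem_GG, mem_lowers]
          constructor
          · rintro ⟨⟨h1, h2⟩, h3⟩
            by_cases hxU : x0 ∈ U
            · left
              refine ⟨⟨h1, h2⟩, fun x hx hpx => ?_⟩
              rcases hpx.lt_or_eq with h4 | h4
              · exact h3 x hx h4
              · have hxP : x.1 = P := Fin.ext h4.symm
                refine h2 x0 hxU x hx ?_
                rw [mem_cells, hxP] at hx
                rw [Prod.le_def]
                exact ⟨hxP.le, by simp only [hx0]; omega⟩
            · right
              refine ⟨⟨fun x hx => ?_, fun x hx y hy => h2 x hx y ((hcell y).2 (Or.inr hy))⟩,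
                fun x hx => h3 x ((hcell x).2 (Or.inr hx))⟩
              rcases (hcell x).1 (h1 hx) with rfl | h
              · exact absurd hx hxU
              · exact h
          · rintro (⟨⟨h1, h2⟩, h3⟩ | ⟨⟨h1, h2⟩, h3⟩)
            · exact ⟨⟨h1, h2⟩, fun x hx hpx => h3 x hx (by omega)⟩
            · refine ⟨⟨fun x hx => (hcell x).2 (Or.inr (h1 hx)), ?_⟩, ?_⟩
              · intro x hx y hy hyx
                rcases (hcell y).1 hy with rfl | h
                · have := hmax x ((hcell x).2 (Or.inr (h1 hx))) hyx
                  rw [this] at hx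
                  exact hx
                · exact h2 x hx y h hyx
              · intro x hx hpx
                rcases (hcell x).1 hx with rfl | h
                · simp [hx0, hP] at hpx
                · exact h3 x h hpx
        have hdis : Disjoint (GG μ ν p) (GG μ ν' (p + 1)) := by
          rw [Finset.disjoint_left]
          intro U h1 h2
          rw [mem_GG] at h1 h2
          have := h1.2 x0 ((hcell x0).2 (Or.inl rfl)) (by simp [hx0, hP])
          exact hx0n ((mem_lowers.1 h2.1).1 this)
        rw [e1, Finset.sum_union hdis, ih ν hν hμν, ihN ν' hanti hμν' (by rw [hPv]; omega)]
        exact (KM_step (t : ℚ) P μ ν).symm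

theorem KM_zero : ∀ {k : ℕ} (μ ν : Fin k → ℤ), Antitone μ → Antitone ν → μ ≤ ν →
    (KM (0 : ℚ) 0 μ ν).det = if μ = ν then 1 else 0 := by
  intro k
  induction k with
  | zero =>
    intro μ ν _ _ _
    rw [Matrix.det_isEmpty, if_pos (Subsingleton.elim _ _)]
  | succ k ih =>
    intro μ ν hμ hν hμν
    by_cases h0 : μ 0 = ν 0
    · have hcol : ∀ i : Fin k, KM (0 : ℚ) 0 μ ν i.succ 0 = 0 := by
        intro i
        refine hq_neg _ ?_
        have := hν (Fin.zero_le i.succ)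
        simp only [Fin.val_succ, Fin.val_zero]
        push_cast
        omega
      have h00 : KM (0 : ℚ) 0 μ ν 0 0 = 1 := by
        simp [KM, h0, hq_zero]
      rw [Matrix.det_succ_column_zero, Fin.sum_univ_succ]
      simp only [hcol, h00]
      have hsub : (KM (0 : ℚ) 0 μ ν).submatrix (Fin.succAbove 0) Fin.succ
          = KM (0 : ℚ) 0 (fun i => μ i.succ) (fun i => ν i.succ) := by
        ext i j
        simp only [Matrix.submatrix_apply, KM, Fin.zero_succAbove, Fin.val_succ]
        congr 1
        · push_cast; simp
        · push_cast; ring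
      rw [hsub, ih _ _ (fun i j h => hμ (Fin.succ_le_succ_iff.2 h))
        (fun i j h => hν (Fin.succ_le_succ_iff.2 h)) (fun i => hμν i.succ)]
      have : (μ = ν) ↔ ((fun i : Fin k => μ i.succ) = fun i => ν i.succ) := by
        constructor
        · rintro rfl; rfl
        · intro h; funext i
          refine Fin.cases h0 (fun i => congrFun h i) i
      simp [this]
    · have hlt : μ 0 < ν 0 := lt_of_le_of_ne (hμν 0) h0
      rw [if_neg (fun h => h0 (congrFun h 0))]
      refine Matrix.det_eq_zero_of_row_eq_zero 0 fun j => ?_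
      have := hμ (Fin.zero_le j)
      have h2 := hq_negnat (R := ℚ) (j : ℕ) (ν 0 - μ j + j) (by omega)
      simp only [KM, Fin.val_zero, Nat.not_lt_zero, if_false]
      push_cast
      convert h2 using 2
      · ring
      · ring

theorem cnt_eq_det {k : ℕ} (μ : Fin k → ℤ) (hμ : Antitone μ) (t : ℕ) :
    ∀ ν : Fin k → ℤ, Antitone ν → μ ≤ ν →
      (cnt t (cells μ ν) : ℚ) = (KM (t : ℚ) 0 μ ν).det := by
  induction t with
  | zero =>
    intro ν hν hμν
    rw [Nat.cast_zero, KM_zero μ ν hμ hν hμν, cnt_zero]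
    have : cells μ ν = ∅ ↔ μ = ν := by
      constructor
      · intro h
        funext i
        by_contra hne
        have hlt : μ i < ν i := lt_of_le_of_ne (hμν i) hne
        have : (i, μ i) ∈ cells μ ν := by rw [mem_cells]; exact ⟨le_rfl, hlt⟩
        rw [h] at this; simp at this
      · rintro rfl
        ext x; rw [mem_cells]; simp
    simp only [this]
    split_ifs <;> simp
  | succ t ih =>
    intro ν hν hμν
    have := GG_step μ hμ t ih k le_rfl ν hν hμν
    rw [KM_full] at this
    rw [cnt_succ]
    push_cast
    rw [← this]
    have : GG μ ν k = lowers (cells μ ν) := by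
      ext U; rw [mem_GG]
      constructor
      · exact fun h => h.1
      · exact fun h => ⟨h, fun x _ hx => absurd x.1.2 (by omega)⟩
    rw [this]

end GT

namespace GT
open Polynomial

theorem hq_coeff_one (d : ℕ) (n : ℤ) (h : (d : ℤ) < n) :
    0 ≤ (-1 : ℚ) ^ d * (hq (X - (d : ℚ[X])) n).coeff 1 := by
  obtain ⟨e, rfl⟩ : ∃ e : ℕ, n = ((d + 1 + e : ℕ) : ℤ) := ⟨(n - d - 1).toNat, by omega⟩
  rw [hq_nat, Finset.prod_range_add, Finset.prod_range_succ]
  have : (∏ l ∈ Finset.range d, (X - (d : ℚ[X]) + (l : ℚ[X]))) * (X - (d : ℚ[X]) + (d : ℚ[X])) *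
      ∏ l ∈ Finset.range e, (X - (d : ℚ[X]) + ((d + 1 + l : ℕ) : ℚ[X])) =
      X * ((∏ l ∈ Finset.range d, (X - (d : ℚ[X]) + (l : ℚ[X]))) *
      ∏ l ∈ Finset.range e, (X + 1 + (l : ℚ[X]))) := by
    rw [sub_add_cancel, mul_comm _ X, mul_assoc]
    congr 2
    refine Finset.prod_congr rfl fun l _ => ?_
    push_cast; ring
  rw [this, coeff_smul, coeff_X_mul, coeff_zero_eq_eval_zero, eval_mul, eval_prod, eval_prod]
  simp only [eval_add, eval_sub, eval_X, eval_natCast, eval_one, zero_add, zero_sub]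
  have e2 : ∏ l ∈ Finset.range d, (-(d : ℚ) + (l : ℚ)) =
      (-1) ^ d * ∏ l ∈ Finset.range d, ((d : ℚ) - (l : ℚ)) := by
    have : ((-1 : ℚ)) ^ d = ∏ l ∈ Finset.range d, (-1 : ℚ) := by simp
    rw [this, ← Finset.prod_mul_distrib]
    exact Finset.prod_congr rfl fun _ _ => by ring
  rw [e2, smul_eq_mul]
  have h1 : 0 ≤ ∏ l ∈ Finset.range d, ((d : ℚ) - (l : ℚ)) := by
    refine Finset.prod_nonneg fun l hl => ?_
    have : (l : ℚ) < d := by exact_mod_cast Finset.mem_range.1 hl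
    linarith
  have h2 : 0 ≤ ∏ l ∈ Finset.range e, (1 + (l : ℚ)) :=
    Finset.prod_nonneg fun l hl => by positivity
  have h3 : (-1 : ℚ) ^ d * (-1) ^ d = 1 := by rw [← mul_pow]; simp
  calc (0 : ℚ) ≤ (1 / ((d + 1 + e).factorial : ℚ)) * ((∏ l ∈ Finset.range d, ((d : ℚ) - (l : ℚ))) *
        ∏ l ∈ Finset.range e, (1 + (l : ℚ))) := by positivity
    _ = ((-1 : ℚ) ^ d * (-1) ^ d) * ((1 / ((d + 1 + e).factorial : ℚ)) *
        ((∏ l ∈ Finset.range d, ((d : ℚ) - (l : ℚ))) *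
        ∏ l ∈ Finset.range e, (1 + (l : ℚ)))) := by rw [h3, one_mul]
    _ = _ := by ring

theorem KM_block {R : Type*} [CommRing R] [Algebra ℚ R] {p q : ℕ} (x : R) (μ ν : Fin (p + q) → ℤ)
    (h : ∀ (i : Fin q) (j : Fin p), KM x 0 μ ν (Fin.natAdd p i) (Fin.castAdd q j) = 0) :
    (KM x 0 μ ν).det = (KM x 0 (fun i => μ (Fin.castAdd q i)) (fun i => ν (Fin.castAdd q i))).det *
      (KM x 0 (fun i => μ (Fin.natAdd p i)) (fun i => ν (Fin.natAdd p i))).det := by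
  rw [← Matrix.det_submatrix_equiv_self finSumFinEquiv (KM x 0 μ ν),
    ← Matrix.fromBlocks_toBlocks ((KM x 0 μ ν).submatrix _ _)]
  have h21 : ((KM x 0 μ ν).submatrix finSumFinEquiv finSumFinEquiv).toBlocks₂₁ = 0 := by
    ext i j
    simpa [Matrix.toBlocks₂₁] using h i j
  rw [h21, Matrix.det_fromBlocks_zero₂₁]
  congr 2
  ext i j
  simp only [Matrix.toBlocks₂₂, Matrix.submatrix_apply, Matrix.of_apply, finSumFinEquiv_apply_right, KM,
    Fin.val_natAdd]
  congr 1
  · push_cast; simp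
  · push_cast; ring

theorem eval_KM {k : ℕ} (x : ℚ) (μ ν : Fin k → ℤ) :
    ((KM (X : ℚ[X]) 0 μ ν).det).eval x = (KM x 0 μ ν).det := by
  have := KM_map (Polynomial.evalRingHom x) (X : ℚ[X]) 0 μ ν
  simpa using this

theorem eval_KM_entry {k : ℕ} (x : ℚ) (μ ν : Fin k → ℤ) (i j : Fin k) :
    (KM (X : ℚ[X]) 0 μ ν i j).eval x = KM x 0 μ ν i j := by
  have := hq_map (Polynomial.evalRingHom x)
    (X + (((i : ℤ) - (j : ℤ) : ℤ) : ℚ[X]) + if (i : ℕ) < 0 then 1 else 0)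
    (ν i - μ j - (i : ℤ) + (j : ℤ))
  simpa [KM] using this

theorem linear_connected {k : ℕ} (μ ν : Fin (k + 1) → ℤ) (hμ : Antitone μ) (hν : Antitone ν)
    (hlt : ∀ i, μ i < ν i) (hc : ∀ i j : Fin (k + 1), (j : ℕ) = i + 1 → μ i < ν j) :
    0 ≤ (derivative (KM (X : ℚ[X]) 0 μ ν).det).eval 0 := by
  have hz : ∀ i j, i ≤ j → KM (0 : ℚ) 0 μ ν i j = 0 := by
    intro i j hij
    have h1 := hν hij
    have h2 := hlt j
    have h3 : (i : ℕ) ≤ j := hij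
    have := hq_negnat (R := ℚ) ((j : ℕ) - (i : ℕ)) (ν i - μ j - (i : ℤ) + (j : ℤ)) (by omega)
    simp only [KM, Nat.not_lt_zero, if_false]
    refine Eq.trans ?_ this
    congr 1
    push_cast [Nat.cast_sub h3]
    ring
  set M := KM (X : ℚ[X]) 0 μ ν with hM
  set Q : Fin (k + 1) → ℚ[X] := fun j => divX (M 0 j) with hQ
  have hrow : M 0 = (X : ℚ[X]) • Q := by
    ext1 j
    simp only [Pi.smul_apply, smul_eq_mul, hQ]
    conv_lhs => rw [← divX_mul_X_add (M 0 j)]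
    have : (M 0 j).coeff 0 = 0 := by
      rw [coeff_zero_eq_eval_zero, hM, eval_KM_entry, hz 0 j (Fin.zero_le j)]
    rw [this]; simp [mul_comm]
  have hdet : M.det = X * (M.updateRow 0 Q).det := by
    rw [← Matrix.det_updateRow_smul, ← hrow, Matrix.updateRow_eq_self]
  rw [hdet]
  simp only [derivative_mul, derivative_X, one_mul, eval_add, eval_mul, eval_X, zero_mul, add_zero]
  set N : Matrix (Fin (k+1)) (Fin (k+1)) ℚ := (Polynomial.evalRingHom (0:ℚ)).mapMatrix (M.updateRow 0 Q) with hN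
  have e1 : ((M.updateRow 0 Q).det).eval 0 = N.det := by
    rw [hN, ← RingHom.map_det]; rfl
  have hN0 : ∀ j, N 0 j = (Q j).eval 0 := by
    intro j; simp [hN]
  have hNs : ∀ (i : Fin k) j, N i.succ j = KM (0 : ℚ) 0 μ ν i.succ j := by
    intro i j
    rw [← eval_KM_entry]
    simp [hN, Matrix.updateRow_apply, Fin.succ_ne_zero, hM]
  rw [e1, Matrix.det_succ_column N (Fin.last k), Fin.sum_univ_succ, Finset.sum_eq_zero, add_zero]
  swap
  · intro i _
    rw [hNs, hz _ _ (Fin.le_last _)]; simp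
  have hsub : (N.submatrix (Fin.succAbove 0) (Fin.last k).succAbove).det = 1 := by
    rw [Matrix.det_of_lowerTriangular]
    · refine Finset.prod_eq_one fun i _ => ?_
      simp only [Matrix.submatrix_apply, Fin.zero_succAbove, Fin.succAbove_last, hNs]
      have := hc i.castSucc i.succ (by simp)
      have := hq_one (ν i.succ - μ i.castSucc - 1) (by omega)
      rw [← this]
      simp only [KM, Nat.not_lt_zero, if_false, Fin.val_succ, Fin.val_castSucc]
      congr 1
      · push_cast; ring
      · push_cast; ring
    · intro i j hij
      simp only [Matrix.submatrix_apply, Fin.zero_succAbove, Fin.succAbove_last, hNs]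
      apply hz
      have : i < j := hij
      rw [Fin.le_def]
      simp
      exact this
  rw [hsub, hN0, mul_one]
  simp only [Fin.val_zero, Fin.val_last, zero_add, hQ]
  rw [← coeff_zero_eq_eval_zero, coeff_divX]
  have h1 := hν (Fin.zero_le (Fin.last k))
  have h2 := hlt (Fin.last k)
  have h3 := hq_coeff_one k (ν 0 - μ (Fin.last k) + k) (by omega)
  convert h3 using 3
  simp only [hM, KM, Nat.not_lt_zero, if_false, Fin.val_zero, Fin.val_last]
  congr 1
  · push_cast; ring
  · push_cast; ring

theorem linear_nonneg (k : ℕ) : ∀ (μ ν : Fin k → ℤ), Antitone μ → Antitone ν → μ ≤ ν →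
    0 ≤ (derivative (KM (X : ℚ[X]) 0 μ ν).det).eval 0 := by
  induction k using Nat.strong_induction_on with
  | _ k ih =>
  intro μ ν hμ hν hμν
  by_cases hd : ∃ i j : Fin k, (j : ℕ) = i + 1 ∧ ν j ≤ μ i
  · obtain ⟨i, j, hij, hd⟩ := hd
    obtain ⟨p, hp⟩ : ∃ p : ℕ, p = (j : ℕ) := ⟨_, rfl⟩
    obtain ⟨q, hq⟩ : ∃ q, k = p + q := ⟨k - p, by have := j.2; omega⟩
    subst hq
    have hjq := j.2
    rw [KM_block (X : ℚ[X]) μ ν]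
    · have a1 : Antitone (fun i => μ (Fin.castAdd q i)) := fun a b h => hμ (by rw [Fin.le_def] at *; simpa using h)
      have a2 : Antitone (fun i => ν (Fin.castAdd q i)) := fun a b h => hν (by rw [Fin.le_def] at *; simpa using h)
      have b1 : Antitone (fun i => μ (Fin.natAdd p i)) := fun a b h => hμ (by simpa using h)
      have b2 : Antitone (fun i => ν (Fin.natAdd p i)) := fun a b h => hν (by simpa using h)
      have a3 : (fun i => μ (Fin.castAdd q i)) ≤ (fun i => ν (Fin.castAdd q i)) := fun a => hμν _
      have b3 : (fun i => μ (Fin.natAdd p i)) ≤ (fun i => ν (Fin.natAdd p i)) := fun a => hμν _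
      have h1 := ih p (by omega) _ _ a1 a2 a3
      have h2 := ih q (by omega) _ _ b1 b2 b3
      rw [derivative_mul, eval_add, eval_mul, eval_mul, eval_KM, eval_KM, KM_zero _ _ a1 a2 a3,
        KM_zero _ _ b1 b2 b3]
      refine add_nonneg (mul_nonneg h1 ?_) (mul_nonneg ?_ h2) <;> split_ifs <;> simp
    · intro a b
      refine hq_neg _ ?_
      have h1 : ν (Fin.natAdd p a) ≤ ν j := hν (by rw [Fin.le_def]; simp; omega)
      have h2 : μ i ≤ μ (Fin.castAdd q b) := hμ (by rw [Fin.le_def]; simp; omega)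
      have := b.2
      simp only [Fin.val_natAdd, Fin.val_castAdd]
      push_cast
      omega
  · push Not at hd
    rcases k with _ | k
    · simp
    by_cases hlt : ∀ i, μ i < ν i
    · exact linear_connected μ ν hμ hν hlt hd
    · push Not at hlt
      obtain ⟨i, hi⟩ := hlt
      rcases k with _ | k
      · have : μ = ν := by
          funext a
          have h1 : a = i := Fin.ext (by omega)
          subst h1; exact le_antisymm (hμν a) hi
        subst this
        simp [KM, hq_zero]
      · exfalso
        by_cases h : (i : ℕ) + 1 < k + 1 + 1
        · have h1 := hd i ⟨i + 1, h⟩ rfl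
          have h2 : ν ⟨i + 1, h⟩ ≤ ν i := hν (by rw [Fin.le_def]; simp)
          omega
        · have h1 := hd ⟨i - 1, by omega⟩ i (by simp; omega)
          have h2 : μ i ≤ μ ⟨i - 1, by omega⟩ := hμ (by rw [Fin.le_def]; simp)
          omega

theorem exists_bound (F : Finset ℤ) (N0 : ℤ) (hN0 : ∀ x ∈ F, N0 ≤ x) :
    ∃ L : ℤ, N0 ≤ L ∧ (∀ c, N0 ≤ c → (c < L ↔ ∃ x ∈ F, c ≤ x)) := by
  rcases F.eq_empty_or_nonempty with rfl | h
  · exact ⟨N0, le_rfl, fun c hc => by simp; exact hc⟩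
  · refine ⟨F.max' h + 1, ?_, fun c hc => ⟨fun h' => ⟨F.max' h, F.max'_mem h, by omega⟩, ?_⟩⟩
    · have := hN0 _ (F.max'_mem h); omega
    · rintro ⟨x, hx, hcx⟩
      have := F.le_max' x hx
      omega

theorem exists_shape {k : ℕ} (S : Finset (Fin k × ℤ)) (hS : Cvx S) :
    ∃ μ ν : Fin k → ℤ, Antitone μ ∧ Antitone ν ∧ μ ≤ ν ∧ S = cells μ ν := by
  rcases S.eq_empty_or_nonempty with rfl | hne
  · refine ⟨0, 0, fun _ _ _ => le_rfl, fun _ _ _ => le_rfl, le_rfl, ?_⟩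
    ext x; rw [mem_cells]; simp
  obtain ⟨N0, hN0⟩ : ∃ N0 : ℤ, ∀ x ∈ S, N0 ≤ x.2 := by
    obtain ⟨N, hN⟩ := (S.image Prod.snd).bddBelow
    exact ⟨N, fun x hx => hN (by simpa using ⟨x.1, hx⟩)⟩
  obtain ⟨N1, hN1⟩ : ∃ N1 : ℤ, ∀ x ∈ S, x.2 ≤ N1 := by
    obtain ⟨N, hN⟩ := (S.image Prod.snd).bddAbove
    exact ⟨N, fun x hx => hN (by simpa using ⟨x.1, hx⟩)⟩
  have hν : ∀ i : Fin k, ∃ L : ℤ, N0 ≤ L ∧ (∀ c, N0 ≤ c → (c < L ↔ ∃ x ∈ S, i ≤ x.1 ∧ c ≤ x.2)) := by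
    intro i
    obtain ⟨L, h1, h2⟩ := exists_bound ((S.filter (fun x => i ≤ x.1)).image Prod.snd) N0 (by
      intro x hx
      obtain ⟨y, hy, rfl⟩ := Finset.mem_image.1 hx
      exact hN0 y (Finset.mem_filter.1 hy).1)
    refine ⟨L, h1, fun c hc => (h2 c hc).trans ?_⟩
    constructor
    · rintro ⟨x, hx, hcx⟩
      obtain ⟨y, hy, rfl⟩ := Finset.mem_image.1 hx
      rw [Finset.mem_filter] at hy
      exact ⟨y, hy.1, hy.2, hcx⟩
    · rintro ⟨y, hy, h3, h4⟩
      exact ⟨y.2, Finset.mem_image_of_mem _ (Finset.mem_filter.2 ⟨hy, h3⟩), h4⟩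
  have hμ : ∀ i : Fin k, ∃ L : ℤ, L ≤ N1 ∧ (∀ c, c ≤ N1 → (L < c ↔ ∃ x ∈ S, x.1 ≤ i ∧ x.2 ≤ c)) := by
    intro i
    obtain ⟨L, h1, h2⟩ := exists_bound ((S.filter (fun x => x.1 ≤ i)).image (fun x => - x.2)) (-N1) (by
      intro x hx
      obtain ⟨y, hy, rfl⟩ := Finset.mem_image.1 hx
      have := hN1 y (Finset.mem_filter.1 hy).1
      omega)
    refine ⟨-L, by omega, fun c hc => ?_⟩
    have h3 := h2 (-c) (by omega)
    rw [show -L < c ↔ -c < L by omega, h3]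
    constructor
    · rintro ⟨x, hx, hcx⟩
      obtain ⟨y, hy, rfl⟩ := Finset.mem_image.1 hx
      rw [Finset.mem_filter] at hy
      exact ⟨y, hy.1, hy.2, by omega⟩
    · rintro ⟨y, hy, h3, h4⟩
      exact ⟨-y.2, Finset.mem_image.2 ⟨y, (Finset.mem_filter.2 ⟨hy, h3⟩), rfl⟩, by omega⟩
  choose ν hν0 hν1 using hν
  choose ρ hρ0 hρ1 using hμ
  have aν : Antitone ν := by
    intro i j hij
    by_contra! h
    obtain ⟨x, hx, h1, h2⟩ := (hν1 j (ν i) (hν0 i)).1 h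
    have := (hν1 i (ν i) (hν0 i)).2 ⟨x, hx, hij.trans h1, h2⟩
    omega
  have aρ : Antitone ρ := by
    intro i j hij
    by_contra! h
    obtain ⟨x, hx, h1, h2⟩ := (hρ1 i (ρ j) (hρ0 j)).1 h
    have := (hρ1 j (ρ j) (hρ0 j)).2 ⟨x, hx, h1.trans hij, h2⟩
    omega
  refine ⟨fun i => min (ρ i + 1) (ν i), ν, ?_, aν, fun i => min_le_right _ _, ?_⟩
  · intro i j hij
    have := aν hij
    have := aρ hij
    simp only
    omega
  · ext ⟨i, c⟩
    rw [mem_cells]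
    simp only
    constructor
    · intro h
      have h0 := hN0 _ h
      have h1 := hN1 _ h
      have h2 := (hν1 i c h0).2 ⟨_, h, le_rfl, le_rfl⟩
      have h3 := (hρ1 i c h1).2 ⟨_, h, le_rfl, le_rfl⟩
      omega
    · rintro ⟨h1, h2⟩
      have h3 : ρ i < c := by omega
      -- upper bound
      obtain ⟨x, hx, hx1, hx2⟩ : ∃ x ∈ S, i ≤ x.1 ∧ c ≤ x.2 := by
        rcases le_or_gt N0 c with h | h
        · exact (hν1 i c h).1 h2
        · have h4 : ρ i < N0 := by omega
          have h6 : N0 < ν i ∨ ν i = N0 := by have := hν0 i; omega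
          have h5 : N0 ≤ N1 ∨ N1 < N0 := by omega
          by_cases hc : c ≤ N1
          · obtain ⟨y, hy, hy1, hy2⟩ := (hρ1 i c hc).1 h3
            have := hN0 y hy
            omega
          · exfalso
            obtain ⟨y, hy⟩ := hne
            have := hN0 y hy
            have := hN1 y hy
            omega
      have hc1 : c ≤ N1 := hx2.trans (hN1 x hx)
      obtain ⟨y, hy, hy1, hy2⟩ := (hρ1 i c hc1).1 h3
      exact hS y hy x hx (i, c) ⟨hy1, hy2⟩ ⟨hx1, hx2⟩

theorem convex_nonneg {k : ℕ} (S : Finset (Fin k × ℤ)) (hS : Cvx S) :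
    ∃ p : ℚ[X], (∀ t : ℕ, (cnt t S : ℚ) = p.eval (t : ℚ)) ∧ ∀ n, 0 ≤ p.coeff n := by
  refine nonneg_of_linear ?_ S hS
  intro S hS
  obtain ⟨μ, ν, h1, h2, h3, rfl⟩ := exists_shape S hS
  refine ⟨(KM (X : ℚ[X]) 0 μ ν).det, fun t => ?_, linear_nonneg k μ ν h1 h2 h3⟩
  rw [eval_KM, cnt_eq_det μ h1 t ν h2 h3]

end GT

namespace GT

section W
variable {α : Type*} [PartialOrder α] [DecidableEq α] [Fintype α]

open Classical in
/-- monotone functions on `S`, zero outside, with values in `B` -/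
noncomputable def Wset (S : Finset α) (B : α → Finset ℤ) : Finset (α → ℤ) :=
  (Fintype.piFinset fun p => if p ∈ S then B p else {0}).filter
    fun g => ∀ p ∈ S, ∀ q ∈ S, p ≤ q → g p ≤ g q

theorem mem_Wset {S : Finset α} {B : α → Finset ℤ} {g : α → ℤ} :
    g ∈ Wset S B ↔ (∀ p ∈ S, g p ∈ B p) ∧ (∀ p, p ∉ S → g p = 0) ∧
      ∀ p ∈ S, ∀ q ∈ S, p ≤ q → g p ≤ g q := by
  simp only [Wset, Finset.mem_filter, Fintype.mem_piFinset, ← and_assoc]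
  refine and_congr_left fun _ => ?_
  constructor
  · intro h
    exact ⟨fun p hp => by simpa [hp] using h p, fun p hp => by simpa [hp] using h p⟩
  · rintro ⟨h1, h2⟩ p
    by_cases hp : p ∈ S
    · simpa [hp] using h1 p hp
    · simpa [hp] using h2 p hp

theorem Wset_congr {S : Finset α} {B B' : α → Finset ℤ} (h : ∀ p ∈ S, B p = B' p) :
    Wset S B = Wset S B' := by
  ext g
  simp only [mem_Wset]
  refine and_congr_left fun _ => ?_
  exact forall₂_congr fun p hp => by rw [h p hp]

theorem Wset_split (S : Finset α) (B : α → Finset ℤ) (b : ℤ) :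
    (Wset S B).card = ∑ U ∈ lowers S, (Wset U fun p => (B p).filter (· ≤ b)).card *
      (Wset (S \ U) fun p => (B p).filter (b < ·)).card := by
  rw [Finset.card_eq_sum_card_fiberwise (f := fun g => S.filter fun p => g p ≤ b) (t := lowers S)]
  · refine Finset.sum_congr rfl fun U hU => ?_
    rw [mem_lowers] at hU
    rw [← Finset.card_product]
    refine Finset.card_bij' (fun g _ => (fun p => if p ∈ U then g p else 0, fun p => if p ∈ S \ U then g p else 0))
      (fun g _ => g.1 + g.2) ?_ ?_ ?_ ?_
    · intro g hg
      simp only [Finset.mem_filter, mem_Wset] at hg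
      obtain ⟨⟨h1, h2, h3⟩, rfl⟩ := hg
      rw [Finset.mem_product, mem_Wset, mem_Wset]
      refine ⟨⟨?_, ?_, ?_⟩, ?_, ?_, ?_⟩
      · intro p hp
        simp only [hp, if_true]
        simp only [Finset.mem_filter] at hp ⊢
        exact ⟨h1 p hp.1, hp.2⟩
      · intro p hp; simp only [hp, if_false]
      · intro p hp q hq hpq
        simp only [hp, hq, if_true]
        simp only [Finset.mem_filter] at hp hq
        exact h3 p hp.1 q hq.1 hpq
      · intro p hp
        simp only [hp, if_true]
        simp only [Finset.mem_sdiff, Finset.mem_filter, not_and, not_le] at hp ⊢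
        exact ⟨h1 p hp.1, hp.2 hp.1⟩
      · intro p hp; simp only [hp, if_false]
      · intro p hp q hq hpq
        simp only [hp, hq, if_true]
        simp only [Finset.mem_sdiff] at hp hq
        exact h3 p hp.1 q hq.1 hpq
    · rintro ⟨g1, g2⟩ hg
      rw [Finset.mem_product, mem_Wset, mem_Wset] at hg
      obtain ⟨⟨h1, h2, h3⟩, h4, h5, h6⟩ := hg
      simp only [Finset.mem_filter] at h1 h4
      have e1 : ∀ p ∈ U, g2 p = 0 := fun p hp => h5 p (by simp [hp])
      have e2 : ∀ p, p ∉ U → g1 p = 0 := h2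
      rw [Finset.mem_filter, mem_Wset]
      refine ⟨⟨?_, ?_, ?_⟩, ?_⟩
      · intro p hp
        by_cases hpU : p ∈ U
        · simpa [e1 p hpU] using (h1 p hpU).1
        · simpa [e2 p hpU] using (h4 p (Finset.mem_sdiff.2 ⟨hp, hpU⟩)).1
      · intro p hp
        simp only [Pi.add_apply]
        rw [e2 p (fun h => hp (hU.1 h)), show g2 p = 0 from h5 p (fun h => hp (Finset.mem_sdiff.1 h).1)]; rfl
      · intro p hp q hq hpq
        simp only [Pi.add_apply]
        by_cases hpU : p ∈ U
        · by_cases hqU : q ∈ U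
          · rw [e1 p hpU, e1 q hqU]; simpa using h3 p hpU q hqU hpq
          · rw [e1 p hpU, e2 q hqU]
            have := (h1 p hpU).2
            have := (h4 q (Finset.mem_sdiff.2 ⟨hq, hqU⟩)).2
            omega
        · have hqU : q ∉ U := fun h => hpU (hU.2 q h p hp hpq)
          rw [e2 p hpU, e2 q hqU]
          simpa using h6 p (Finset.mem_sdiff.2 ⟨hp, hpU⟩) q (Finset.mem_sdiff.2 ⟨hq, hqU⟩) hpq
      · ext p
        simp only [Finset.mem_filter, Pi.add_apply]
        constructor
        · rintro ⟨hp, hle⟩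
          by_contra hpU
          have := (h4 p (Finset.mem_sdiff.2 ⟨hp, hpU⟩)).2
          rw [e2 p hpU] at hle
          omega
        · intro hp
          refine ⟨hU.1 hp, ?_⟩
          rw [e1 p hp]
          have := (h1 p hp).2
          omega
    · intro g hg
      simp only [Finset.mem_filter, mem_Wset] at hg
      obtain ⟨⟨h1, h2, h3⟩, _⟩ := hg
      funext p
      simp only [Pi.add_apply, Finset.mem_sdiff]
      by_cases hpU : p ∈ U
      · simp [hpU]
      · by_cases hp : p ∈ S
        · simp [hpU, hp]
        · simp [hpU, hp, h2 p hp]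
    · rintro ⟨g1, g2⟩ hg
      rw [Finset.mem_product, mem_Wset, mem_Wset] at hg
      obtain ⟨⟨h1, h2, h3⟩, h4, h5, h6⟩ := hg
      have e1 : ∀ p ∈ U, g2 p = 0 := fun p hp => h5 p (by simp [hp])
      simp only [Prod.mk.injEq]
      constructor
      · funext p
        by_cases hpU : p ∈ U
        · simp [hpU, e1 p hpU]
        · simp only [hpU, if_false]; exact (h2 p hpU).symm
      · funext p
        by_cases hp : p ∈ S \ U
        · simp only [hp, if_true, Pi.add_apply]
          rw [show g1 p = 0 from h2 p (Finset.mem_sdiff.1 hp).2, zero_add]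
        · simp only [hp, if_false]; exact (h5 p hp).symm
  · intro g hg
    rw [Finset.mem_coe, mem_Wset] at hg
    rw [Finset.mem_coe, mem_lowers]
    refine ⟨Finset.filter_subset _ _, fun p hp q hq hqp => ?_⟩
    rw [Finset.mem_filter] at hp ⊢
    exact ⟨hq, (hg.2.2 q hq p hp.1 hqp).trans hp.2⟩

theorem Wset_singleton (S : Finset α) (B : α → Finset ℤ) (b : ℤ) (h : ∀ p ∈ S, B p = {b}) :
    (Wset S B).card = 1 := by
  rw [Finset.card_eq_one]
  refine ⟨fun p => if p ∈ S then b else 0, ?_⟩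
  ext g
  rw [mem_Wset, Finset.mem_singleton]
  constructor
  · rintro ⟨h1, h2, _⟩
    funext p
    by_cases hp : p ∈ S
    · have := h1 p hp
      rw [h p hp, Finset.mem_singleton] at this
      simp [hp, this]
    · simp [hp, h2 p hp]
  · rintro rfl
    refine ⟨fun p hp => by simp [hp, h p hp], fun p hp => by simp [hp], fun p hp q hq _ => by simp [hp, hq]⟩

theorem Wset_eq_zero (S : Finset α) (B : α → Finset ℤ) (p : α) (hp : p ∈ S) (h : B p = ∅) :
    (Wset S B).card = 0 := by
  rw [Finset.card_eq_zero, Finset.eq_empty_iff_forall_notMem]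
  intro g hg
  have := (mem_Wset.1 hg).1 p hp
  rw [h] at this
  simp at this

theorem Wset_cnt (t : ℕ) (a : ℤ) (S : Finset α) :
    (Wset S fun _ => Finset.Ioc a (a + t)).card = cnt t S := by
  induction t generalizing S with
  | zero =>
    rw [cnt_zero]
    split_ifs with h
    · subst h
      exact Wset_singleton _ _ 0 (by simp)
    · obtain ⟨p, hp⟩ := Finset.nonempty_iff_ne_empty.2 h
      exact Wset_eq_zero _ _ p hp (by simp)
  | succ t ih =>
    rw [Wset_split S _ (a + t), cnt_succ]
    refine Finset.sum_congr rfl fun U hU => ?_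
    rw [Wset_singleton (S \ U) _ (a + t + 1), mul_one, ← ih]
    · congr 1
      refine Wset_congr fun p _ => ?_
      ext x; simp only [Finset.mem_filter, Finset.mem_Ioc]; push_cast; omega
    · intro p _
      ext x; simp only [Finset.mem_filter, Finset.mem_Ioc, Finset.mem_singleton]; push_cast; omega

/-- `MvPolynomial` with nonnegative coefficients -/
def NN (r : ℕ) : Subsemiring (MvPolynomial (Fin r) ℚ) where
  carrier := {f | ∀ d, 0 ≤ f.coeff d}
  mul_mem' := by
    classical
    intro f g hf hg d
    rw [MvPolynomial.coeff_mul]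
    exact Finset.sum_nonneg fun x _ => mul_nonneg (hf _) (hg _)
  one_mem' := by
    classical
    intro d
    rw [MvPolynomial.coeff_one]
    split_ifs <;> simp
  add_mem' := by
    intro f g hf hg d
    rw [MvPolynomial.coeff_add]
    exact add_nonneg (hf d) (hg d)
  zero_mem' := by intro d; simp

theorem aeval_mem_NN {r : ℕ} (i : Fin r) (p : Polynomial ℚ) (hp : ∀ n, 0 ≤ p.coeff n) :
    Polynomial.aeval (MvPolynomial.X i : MvPolynomial (Fin r) ℚ) p ∈ NN r := by
  classical
  rw [Polynomial.aeval_eq_sum_range]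
  refine Subsemiring.sum_mem _ fun n _ d => ?_
  rw [MvPolynomial.coeff_smul]
  refine mul_nonneg (hp n) ?_
  rw [MvPolynomial.coeff_X_pow]
  split_ifs <;> simp

theorem eval_aeval {r : ℕ} (i : Fin r) (p : Polynomial ℚ) (v : Fin r → ℚ) :
    MvPolynomial.eval v (Polynomial.aeval (MvPolynomial.X i : MvPolynomial (Fin r) ℚ) p) =
      p.eval (v i) := by
  rw [Polynomial.aeval_eq_sum_range, map_sum, Polynomial.eval_eq_sum_range]
  refine Finset.sum_congr rfl fun n _ => ?_
  rw [MvPolynomial.smul_eval]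
  simp

open Classical in
/-- allowed values for marked monotone maps at stage `s` -/
noncomputable def Bnd {r : ℕ} (a : Fin (r + 1) → α) (lam : α → ℤ) (s : Fin (r + 1)) (p : α) :
    Finset ℤ :=
  if p ∈ Set.range a then {lam p} else Finset.Icc (lam (a 0)) (lam (a s))

set_option maxHeartbeats 2000000 in
theorem stage {r : ℕ} (a : Fin (r + 1) → α) (hinj : Function.Injective a)
    (hnat : ∀ i j : Fin (r + 1), a i < a j → i < j)
    (HT : ∀ T : Finset α, Cvx T → (∀ p ∈ T, p ∉ Set.range a) →
      ∃ p : Polynomial ℚ, (∀ t : ℕ, (cnt t T : ℚ) = p.eval (t : ℚ)) ∧ ∀ n, 0 ≤ p.coeff n)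
    (s : ℕ) (hs : s < r + 1) : ∀ S : Finset α, (∀ p ∈ S, ∀ q, q ≤ p → q ∈ S) →
      (∀ i : Fin (r + 1), a i ∈ S ↔ (i : ℕ) ≤ s) →
      ∃ f ∈ NN r, ∀ lam : α → ℤ, (∀ i j : Fin (r + 1), i ≤ j → lam (a i) ≤ lam (a j)) →
        ((Wset S (Bnd a lam ⟨s, hs⟩)).card : ℚ) = MvPolynomial.eval
          (fun i : Fin r => ((lam (a i.succ) : ℚ) - (lam (a i.castSucc) : ℚ))) f := by
  have hnat' : ∀ i j : Fin (r + 1), a i ≤ a j → i ≤ j := by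
    intro i j h
    rcases h.lt_or_eq with h | h
    · exact (hnat i j h).le
    · exact (hinj h).le
  induction s with
  | zero =>
    intro S hS hSa
    refine ⟨1, Subsemiring.one_mem _, fun lam hlam => ?_⟩
    rw [Wset_singleton S _ (lam (a 0))]
    · simp
    · intro p hp
      unfold Bnd
      split_ifs with h
      · obtain ⟨i, rfl⟩ := h
        have := (hSa i).1 hp
        rw [show i = 0 from Fin.ext (by simpa using this)]
      · exact Finset.Icc_self _
  | succ s ih =>
    intro S hS hSa
    have hs' : s < r := by omega
    set i1 : Fin (r + 1) := ⟨s + 1, hs⟩ with hi1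
    set i0 : Fin (r + 1) := ⟨s, by omega⟩ with hi0
    classical
    set S' : Finset α := S.filter fun p => ¬ a i1 ≤ p with hS'
    have hS'low : ∀ p ∈ S', ∀ q, q ≤ p → q ∈ S' := by
      intro p hp q hqp
      rw [hS', Finset.mem_filter] at hp ⊢
      exact ⟨hS p hp.1 q hqp, fun h => hp.2 (h.trans hqp)⟩
    have hS'a : ∀ i : Fin (r + 1), a i ∈ S' ↔ (i : ℕ) ≤ s := by
      intro i
      rw [hS', Finset.mem_filter, hSa]
      constructor
      · rintro ⟨h1, h2⟩
        by_contra h3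
        exact h2 (by rw [show i = i1 from Fin.ext (by simp [hi1]; omega)])
      · intro h
        refine ⟨by omega, fun h2 => ?_⟩
        have : (i1 : ℕ) ≤ i := hnat' _ _ h2
        simp [hi1] at this
        omega
    -- removal of the forced part
    have step1 : ∀ lam : α → ℤ, (∀ i j : Fin (r + 1), i ≤ j → lam (a i) ≤ lam (a j)) →
        (Wset S (Bnd a lam i1)).card = (Wset S' (Bnd a lam i1)).card := by
      intro lam hlam
      have hcap : ∀ p ∈ S, ∀ x ∈ Bnd a lam i1 p, x ≤ lam (a i1) := by
        intro p hp x hx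
        unfold Bnd at hx
        split_ifs at hx with h
        · obtain ⟨i, rfl⟩ := h
          rw [Finset.mem_singleton] at hx
          rw [hx]
          refine hlam _ _ ?_
          rw [Fin.le_def]; exact (hSa i).1 hp
        · exact (Finset.mem_Icc.1 hx).2
      have hforce : ∀ p ∈ S, a i1 ≤ p → lam (a i1) ∈ Bnd a lam i1 p := by
        intro p hp hle
        unfold Bnd
        split_ifs with h
        · obtain ⟨i, rfl⟩ := h
          have h1 := hnat' _ _ hle
          have h2 : i ≤ i1 := by rw [Fin.le_def]; exact (hSa i).1 hp
          rw [le_antisymm h1 h2]; simp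
        · exact Finset.mem_Icc.2 ⟨hlam _ _ (Fin.zero_le _), le_rfl⟩
      have ha1 : a i1 ∈ S := (hSa i1).2 (by simp [hi1])
      have hval1 : ∀ g ∈ Wset S (Bnd a lam i1), ∀ p ∈ S, a i1 ≤ p → g p = lam (a i1) := by
        intro g hg p hp hle
        rw [mem_Wset] at hg
        refine le_antisymm (hcap p hp _ (hg.1 p hp)) ?_
        have h1 := hg.2.2 _ ha1 p hp hle
        have h2 := hg.1 _ ha1
        unfold Bnd at h2
        rw [if_pos ⟨i1, rfl⟩, Finset.mem_singleton] at h2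
        omega
      refine Finset.card_bij' (fun g _ p => if p ∈ S' then g p else 0)
        (fun g _ p => if p ∈ S ∧ a i1 ≤ p then lam (a i1) else g p) ?_ ?_ ?_ ?_
      · intro g hg
        rw [mem_Wset] at hg ⊢
        have hsub : ∀ p ∈ S', p ∈ S := fun p hp => (Finset.mem_filter.1 hp).1
        refine ⟨fun p hp => ?_, fun p hp => by simp only [hp, if_false], fun p hp q hq hpq => ?_⟩
        · simp only [hp, if_true]; exact hg.1 p (hsub p hp)
        · simp only [hp, hq, if_true]; exact hg.2.2 p (hsub p hp) q (hsub q hq) hpq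
      · intro g hg
        rw [mem_Wset] at hg ⊢
        refine ⟨fun p hp => ?_, fun p hp => ?_, fun p hp q hq hpq => ?_⟩
        · by_cases h : a i1 ≤ p
          · simp only [hp, h, and_self, if_true]; exact hforce p hp h
          · simp only [h, and_false, if_false]
            exact hg.1 p (Finset.mem_filter.2 ⟨hp, h⟩)
        · simp only [hp, false_and, if_false]
          exact hg.2.1 p (fun h => hp (Finset.mem_filter.1 h).1)
        · by_cases h : a i1 ≤ p
          · have h' := h.trans hpq
            simp only [hp, hq, h, h', and_self, if_true, le_refl]
          · by_cases h' : a i1 ≤ q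
            · simp only [hq, h, h', and_false, and_self, if_true, if_false]
              exact hcap p hp _ (hg.1 p (Finset.mem_filter.2 ⟨hp, h⟩))
            · simp only [h, h', and_false, if_false]
              exact hg.2.2 p (Finset.mem_filter.2 ⟨hp, h⟩) q (Finset.mem_filter.2 ⟨hq, h'⟩) hpq
      · intro g hg
        funext p
        by_cases h : p ∈ S ∧ a i1 ≤ p
        · simp only [h, and_self, if_true]
          exact (hval1 g hg p h.1 h.2).symm
        · simp only [h, if_false]
          by_cases hp : p ∈ S
          · have : p ∈ S' := Finset.mem_filter.2 ⟨hp, fun h' => h ⟨hp, h'⟩⟩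
            simp only [this, if_true]
          · rw [(mem_Wset.1 hg).2.1 p hp]; simp
      · intro g hg
        funext p
        by_cases h : p ∈ S'
        · have h2 := (Finset.mem_filter.1 h).2
          simp only [h, if_true, h2, and_false, if_false]
        · simp only [h, if_false]
          exact ((mem_Wset.1 hg).2.1 p h).symm
    -- each term
    have step2 : ∀ U ∈ lowers S', ∃ f ∈ NN r, ∀ lam : α → ℤ,
        (∀ i j : Fin (r + 1), i ≤ j → lam (a i) ≤ lam (a j)) →
        (((Wset U fun p => (Bnd a lam i1 p).filter (· ≤ lam (a i0))).card *
          (Wset (S' \ U) fun p => (Bnd a lam i1 p).filter (lam (a i0) < ·)).card : ℕ) : ℚ) =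
          MvPolynomial.eval
          (fun i : Fin r => ((lam (a i.succ) : ℚ) - (lam (a i.castSucc) : ℚ))) f := by
      intro U hU
      have hU' := mem_lowers.1 hU
      by_cases hall : ∀ i : Fin (r + 1), (i : ℕ) ≤ s → a i ∈ U
      · have hUa : ∀ i : Fin (r + 1), a i ∈ U ↔ (i : ℕ) ≤ s :=
          fun i => ⟨fun h => (hS'a i).1 (hU'.1 h), hall i⟩
        have hUlow : ∀ p ∈ U, ∀ q, q ≤ p → q ∈ U := fun p hp q hqp =>
          hU'.2 p hp q (hS'low p (hU'.1 hp) q hqp) hqp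
        obtain ⟨f, hf, hfe⟩ := ih (by omega) U hUlow hUa
        have hTa : ∀ p ∈ S' \ U, p ∉ Set.range a := by
          rintro _ hp ⟨i, rfl⟩
          rw [Finset.mem_sdiff] at hp
          exact hp.2 (hall i ((hS'a i).1 hp.1))
        have hTc : Cvx (S' \ U) := by
          intro p hp q hq x h1 h2
          rw [Finset.mem_sdiff] at *
          exact ⟨hS'low q hq.1 x h2, fun h => hp.2 (hUlow x h p h1)⟩
        obtain ⟨P, hP, hPn⟩ := HT _ hTc hTa
        refine ⟨f * Polynomial.aeval (MvPolynomial.X ⟨s, hs'⟩) P,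
          Subsemiring.mul_mem _ hf (aeval_mem_NN _ _ hPn), fun lam hlam => ?_⟩
        have hle : lam (a i0) ≤ lam (a i1) := hlam _ _ (by rw [Fin.le_def]; simp [hi0, hi1])
        rw [map_mul, eval_aeval, ← hfe lam hlam]
        have e0 : (Wset U fun p => (Bnd a lam i1 p).filter (· ≤ lam (a i0))) =
            Wset U (Bnd a lam i0) := by
          refine Wset_congr fun p hp => ?_
          unfold Bnd
          split_ifs with h
          · obtain ⟨i, rfl⟩ := h
            have : lam (a i) ≤ lam (a i0) := hlam _ _ (by
              rw [Fin.le_def]; exact (hUa i).1 hp)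
            ext x; simp only [Finset.mem_filter, Finset.mem_singleton]
            constructor
            · exact fun h => h.1
            · intro h; exact ⟨h, by omega⟩
          · ext x; simp only [Finset.mem_filter, Finset.mem_Icc]
            omega
        have e' : ((Wset (S' \ U) fun p => (Bnd a lam i1 p).filter (lam (a i0) < ·)).card : ℚ) =
            P.eval ((lam (a i1) : ℚ) - (lam (a i0) : ℚ)) := by
          have e : (Wset (S' \ U) fun p => (Bnd a lam i1 p).filter (lam (a i0) < ·)) =
              Wset (S' \ U) fun _ => Finset.Ioc (lam (a i0))
                (lam (a i0) + ((lam (a i1) - lam (a i0)).toNat : ℕ)) := by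
            refine Wset_congr fun p hp => ?_
            unfold Bnd
            rw [if_neg (hTa p hp)]
            have h0 : lam (a 0) ≤ lam (a i0) := hlam _ _ (Fin.zero_le _)
            ext x; simp only [Finset.mem_filter, Finset.mem_Icc, Finset.mem_Ioc]
            omega
          rw [e, Wset_cnt, hP]
          congr 1
          have h3 : (((lam (a i1) - lam (a i0)).toNat : ℕ) : ℤ) = lam (a i1) - lam (a i0) := by omega
          have h4 : (((lam (a i1) - lam (a i0)).toNat : ℕ) : ℚ) = ((lam (a i1) - lam (a i0) : ℤ) : ℚ) := by
            rw [← h3]; norm_cast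
          rw [h4, Int.cast_sub]
        rw [e0, Nat.cast_mul, e']
        rfl
      · push Not at hall
        obtain ⟨i, his, hiU⟩ := hall
        refine ⟨0, Subsemiring.zero_mem _, fun lam hlam => ?_⟩
        rw [Wset_eq_zero (S' \ U) _ (a i) (Finset.mem_sdiff.2 ⟨(hS'a i).2 his, hiU⟩)]
        · simp
        · unfold Bnd
          rw [if_pos ⟨i, rfl⟩]
          have : lam (a i) ≤ lam (a i0) := hlam _ _ (by rw [Fin.le_def]; exact his)
          ext x; simp; rintro rfl; exact this
    choose! f hf hfe using step2
    refine ⟨∑ U ∈ lowers S', f U, Subsemiring.sum_mem _ hf, fun lam hlam => ?_⟩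
    rw [step1 lam hlam, Wset_split S' _ (lam (a i0)), map_sum, Nat.cast_sum]
    exact Finset.sum_congr rfl fun U hU => hfe U hU lam hlam

end W
end GT

namespace GT

instance (k m : ℕ) : Fintype (GTPoset k m) := inferInstanceAs (Fintype (Fin k × Fin (m + 2)))
instance (k m : ℕ) : DecidableEq (GTPoset k m) :=
  inferInstanceAs (DecidableEq (Fin k × Fin (m + 2)))

/-- the element `(i, j)` -/
def pt {k m : ℕ} (i : Fin k) (j : Fin (m + 2)) : GTPoset k m := (i, j)

theorem pt_fst {k m : ℕ} (i : Fin k) (j : Fin (m + 2)) : (pt i j).1 = i := rfl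
theorem pt_snd {k m : ℕ} (i : Fin k) (j : Fin (m + 2)) : (pt i j).2 = j := rfl

theorem GTPoset_le {k m : ℕ} {p q : GTPoset k m} :
    p ≤ q ↔ (p.1 : ℕ) ≤ q.1 ∧ (p.1 : ℕ) + (p.2 : ℕ) ≤ (q.1 : ℕ) + (q.2 : ℕ) := Iff.rfl

/-- the embedding of the Gelfand-Tsetlin poset in a product of chains -/
noncomputable def emb (k m : ℕ) : GTPoset k m ↪o Fin k × ℤ :=
  OrderEmbedding.ofMapLEIff (fun p => (p.1, ((p.1 : ℕ) : ℤ) + ((p.2 : ℕ) : ℤ))) (by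
    intro p q
    rw [GTPoset_le, Prod.mk_le_mk, Fin.le_def]
    refine and_congr_right fun _ => ?_
    norm_cast)

theorem emb_apply {k m : ℕ} (p : GTPoset k m) :
    emb k m p = (p.1, ((p.1 : ℕ) : ℤ) + ((p.2 : ℕ) : ℤ)) := rfl

theorem poset_HT {k m : ℕ} (T : Finset (GTPoset k m)) (hT : Cvx T)
    (hA : ∀ p ∈ T, ¬ ((p.2 : ℕ) = 0 ∨ (p.2 : ℕ) = m + 1)) :
    ∃ p : Polynomial ℚ, (∀ t : ℕ, (cnt t T : ℚ) = p.eval (t : ℚ)) ∧ ∀ n, 0 ≤ p.coeff n := by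
  have hc : Cvx (T.map (emb k m).toEmbedding) := by
    intro p hp q hq x hpx hxq
    rw [Finset.mem_map] at hp hq
    obtain ⟨p, hp, rfl⟩ := hp
    obtain ⟨q, hq, rfl⟩ := hq
    obtain ⟨i, c⟩ := x
    change emb k m p ≤ (i, c) at hpx
    change (i, c) ≤ emb k m q at hxq
    rw [emb_apply, Prod.mk_le_mk, Fin.le_def] at hpx hxq
    by_cases h1 : c < (i : ℕ)
    · exfalso
      refine hA _ (hT p hp q hq (pt i 0) ?_ ?_) (Or.inl rfl)
      · rw [GTPoset_le]; simp [pt_fst, pt_snd]; omega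
      · rw [GTPoset_le]; simp [pt_fst, pt_snd]; omega
    by_cases h2 : c > (i : ℕ) + m + 1
    · exfalso
      refine hA _ (hT p hp q hq (pt i (Fin.last (m + 1))) ?_ ?_) (Or.inr rfl)
      · have := p.2.2
        rw [GTPoset_le]; simp [pt_fst, pt_snd]; omega
      · rw [GTPoset_le]; simp [pt_fst, pt_snd]; omega
    have h3 : (c - (i : ℕ)).toNat < m + 2 := by omega
    rw [Finset.mem_map]
    refine ⟨pt i ⟨(c - (i : ℕ)).toNat, h3⟩, ?_, ?_⟩
    · refine hT p hp q hq _ ?_ ?_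
      · rw [GTPoset_le]; simp [pt_fst, pt_snd]; omega
      · rw [GTPoset_le]; simp [pt_fst, pt_snd]; omega
    · change emb k m _ = _
      rw [emb_apply]
      refine Prod.ext rfl ?_
      simp [pt_fst, pt_snd]; omega
  obtain ⟨P, h1, h2⟩ := convex_nonneg _ hc
  exact ⟨P, fun t => by rw [← h1, cnt_map], h2⟩

end GT

/-- **Theorem (multivariate Ehrhart positivity for skew Gelfand–Tsetlin
polytopes).**  Let `P` be the Gelfand–Tsetlin poset on
`{(i, j) : i ∈ [k], 0 ≤ j ≤ m + 1}` and let `A = {(i, j) ∈ P : j ∈ {0, m + 1}}`,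
so that marked order polytopes over `(P, A)` are exactly the skew Gelfand–Tsetlin
polytopes.  Then for any natural labeling `A = {a_0, …, a_r}` there is a polynomial
`f ∈ ℚ[t_1, …, t_r]` with nonnegative coefficients such that
`Ω_{P,A}(λ) = f(λ(a_1) − λ(a_0), …, λ(a_r) − λ(a_{r−1}))` for every `λ : A → ℤ`
with `λ(a_0) ≤ ⋯ ≤ λ(a_r)`. -/
theorem gelfandTsetlin_multivariate_positivity
    (k m : ℕ) (hk : 0 < k) (hm : 0 < m)
    (A : Set (GTPoset k m))
    (hA : A = {p : GTPoset k m | (p.2 : ℕ) = 0 ∨ (p.2 : ℕ) = m + 1})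
    (r : ℕ) (a : Fin (r + 1) → GTPoset k m) (hinj : Function.Injective a)
    (hrange : Set.range a = A)
    (hnat : ∀ i j : Fin (r + 1), a i < a j → i < j) :
    ∃ f : MvPolynomial (Fin r) ℚ,
      (∀ d : Fin r →₀ ℕ, 0 ≤ f.coeff d) ∧
      ∀ lam : GTPoset k m → ℤ,
        (∀ i j : Fin (r + 1), i ≤ j → lam (a i) ≤ lam (a j)) →
        (markedCount A lam : ℚ) =
          MvPolynomial.eval
            (fun i : Fin r => ((lam (a i.succ) : ℚ) - (lam (a i.castSucc) : ℚ))) f := by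
  obtain ⟨f, hf, hfe⟩ := GT.stage a hinj hnat (fun T hT h => GT.poset_HT T hT (fun p hp hp' =>
    h p hp (by rw [hrange, hA]; exact hp'))) r (Nat.lt_succ_self r) Finset.univ
    (fun _ _ _ _ => Finset.mem_univ _)
    (fun i => ⟨fun _ => Nat.lt_succ_iff.1 i.2, fun _ => Finset.mem_univ _⟩)
  refine ⟨f, hf, fun lam hlam => ?_⟩
  rw [← hfe lam hlam]
  congr 1
  refine Nat.subtype_card _ fun g => ?_
  rw [GT.mem_Wset]
  constructor
  · rintro ⟨h1, -, h3⟩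
    refine ⟨fun p q hpq => h3 p (Finset.mem_univ _) q (Finset.mem_univ _) hpq, fun p hp => ?_⟩
    have := h1 p (Finset.mem_univ _)
    unfold GT.Bnd at this
    rw [if_pos (by rw [hrange]; exact hp), Finset.mem_singleton] at this
    exact this
  · rintro ⟨h1, h2⟩
    refine ⟨fun p _ => ?_, fun p hp => absurd (Finset.mem_univ p) hp, fun p _ q _ hpq => h1 hpq⟩
    unfold GT.Bnd
    split_ifs with h
    · rw [Finset.mem_singleton]
      exact h2 p (by rw [← hrange]; exact h)
    · have hb : GT.pt p.1 0 ∈ A := by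
        rw [hA]; exact Or.inl rfl
      have ht : GT.pt p.1 (Fin.last (m + 1)) ∈ A := by
        rw [hA]; exact Or.inr rfl
      have e1 := h1 (show GT.pt p.1 0 ≤ p by
        rw [GT.GTPoset_le]; simp [GT.pt_fst, GT.pt_snd])
      have e2 := h1 (show p ≤ GT.pt p.1 (Fin.last (m + 1)) by
        have := p.2.2
        rw [GT.GTPoset_le]; simp [GT.pt_fst, GT.pt_snd]; omega)
      rw [h2 _ hb] at e1
      rw [h2 _ ht] at e2
      rw [← hrange] at hb ht
      obtain ⟨i, hi⟩ := hb
      obtain ⟨j, hj⟩ := ht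
      rw [← hi] at e1
      rw [← hj] at e2
      rw [Finset.mem_Icc]
      exact ⟨(hlam 0 i (Fin.zero_le _)).trans e1, e2.trans (hlam j _ (Fin.le_last j))⟩
end
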